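/- arXiv:2504.04848 — 3 statements merged into one kernel-verified Lean document; each statement's English description precedes it below -/
import Mathlib

section
/- A real Banach space X is reflexive if and only if for every norm ‖·‖ on X equivalent to the original norm, the set of all aLUR points of the unit sphere S_{(X,‖·‖)} coincides with the set of all NSE points of S_{(X,‖·‖)}. -/
open Filter Topology NormedSpace

/-- `N` is a norm on `Z` equivalent to the original norm of `Z`. -/
structure IsEquivNorm {Z : Type*} [NormedAddCommGroup Z] [NormedSpace ℝ Z]
    (N : Z → ℝ) : Prop where
  add_le : ∀ x y : Z, N (x + y) ≤ N x + N y
  smul_eq : ∀ (a : ℝ) (x : Z), N (a • x) = |a| * N x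
  lower : ∃ c > (0 : ℝ), ∀ x : Z, c * ‖x‖ ≤ N x
  upper : ∃ C > (0 : ℝ), ∀ x : Z, N x ≤ C * ‖x‖

/-- `f` belongs to the unit sphere of the dual of `(Z, N)`, i.e. its dual norm with respect
to `N` equals `1`. -/
def DualSphere {Z : Type*} [NormedAddCommGroup Z] [NormedSpace ℝ Z]
    (N : Z → ℝ) (f : Z →L[ℝ] ℝ) : Prop :=
  (∀ x : Z, |f x| ≤ N x) ∧ ∀ c : ℝ, (∀ x : Z, |f x| ≤ c * N x) → 1 ≤ c

/-- In the norm `N`, the point `x` is strongly exposed by the functional `f`: every sequence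
in the closed `N`-unit ball on which `f` tends to `1` converges to `x`. -/
def StronglyExposedBy {Z : Type*} [NormedAddCommGroup Z] [NormedSpace ℝ Z]
    (N : Z → ℝ) (x : Z) (f : Z →L[ℝ] ℝ) : Prop :=
  ∀ xs : ℕ → Z, (∀ n, N (xs n) ≤ 1) →
    Tendsto (fun n => f (xs n)) atTop (𝓝 1) → Tendsto xs atTop (𝓝 x)

/-- `x` is a nicely strongly exposed (NSE) point of the unit sphere of `(Z, N)`. -/
def NSEPoint {Z : Type*} [NormedAddCommGroup Z] [NormedSpace ℝ Z]
    (N : Z → ℝ) (x : Z) : Prop :=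
  ∀ f : Z →L[ℝ] ℝ, DualSphere N f → f x = 1 → StronglyExposedBy N x f

/-- `x` is an almost locally uniformly rotund (aLUR) point of the unit sphere of `(Z, N)`. -/
def ALURPoint {Z : Type*} [NormedAddCommGroup Z] [NormedSpace ℝ Z]
    (N : Z → ℝ) (x : Z) : Prop :=
  ∀ (xs : ℕ → Z) (fs : ℕ → Z →L[ℝ] ℝ) (α : ℕ → ℝ),
    (∀ n, N (xs n) = 1) → (∀ m, DualSphere N (fs m)) →
    (∀ m, Tendsto (fun n => fs m ((2 : ℝ)⁻¹ • (xs n + x))) atTop (𝓝 (α m))) →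
    Tendsto α atTop (𝓝 1) →
    Tendsto xs atTop (𝓝 x)


section FunctionalAnalysis

lemma exists_le_norm_sub_of_isClosed {X : Type*} [NormedAddCommGroup X] {S : Set X}
    (hS : IsClosed S) {z : X} (hz : z ∉ S) :
    ∃ d > 0, ∀ s ∈ S, d ≤ ‖z - s‖ := by
  obtain ⟨d, hd, hball⟩ := Metric.isOpen_iff.1 hS.isOpen_compl z hz
  refine ⟨d, hd, fun s hs => ?_⟩
  by_contra! hlt
  exact hball (by rwa [Metric.mem_ball, dist_comm, dist_eq_norm]) hs

variable {X : Type*} [NormedAddCommGroup X] [NormedSpace ℝ X]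

/-- Goldstine's theorem in finitary form: on finitely many functionals, an element of the double
dual is approximated by an element of the space of no larger norm. -/
lemma exists_approx_doubleDual (z : StrongDual ℝ (StrongDual ℝ X)) (s : Finset (StrongDual ℝ X))
    {ε : ℝ} (hε : 0 < ε) : ∃ x : X, ‖x‖ ≤ ‖z‖ ∧ ∀ f ∈ s, |f x - z f| < ε := by
  classical
  let T : X →L[ℝ] (s → ℝ) := ContinuousLinearMap.pi fun f => f.1
  let v : s → ℝ := fun f => z f.1
  by_cases hv : v ∈ closure (T '' Metric.closedBall 0 ‖z‖)
  · obtain ⟨_, ⟨x, hx, rfl⟩, hd⟩ := Metric.mem_closure_iff.1 hv ε hε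
    refine ⟨x, by simpa using hx, fun f hf => ?_⟩
    have := (dist_le_pi_dist v (T x) ⟨f, hf⟩).trans_lt hd
    rwa [dist_comm, Real.dist_eq] at this
  · exfalso
    have hconv : Convex ℝ (closure (T '' Metric.closedBall 0 ‖z‖)) :=
      ((convex_closedBall _ _).linear_image T.toLinearMap).closure
    obtain ⟨φ, u, hu, huv⟩ := geometric_hahn_banach_closed_point hconv isClosed_closure hv
    have hball : ∀ x : X, ‖x‖ ≤ ‖z‖ → φ (T x) < u := fun x hx =>
      hu _ (subset_closure ⟨x, by simpa using hx, rfl⟩)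
    have hφ : ∀ w : s → ℝ, φ w = ∑ f, w f * φ (Pi.single f 1) := fun w => by
      conv_lhs => rw [pi_eq_sum_univ' w]
      simp [map_sum]
    have hh : φ ∘L T = ∑ f : s, φ (Pi.single f 1) • f.1 := by
      ext x
      rw [ContinuousLinearMap.comp_apply, hφ (T x)]
      simp [T, mul_comm]
    have hz : z (φ ∘L T) = φ v := by
      rw [hh, hφ v]
      simp [map_sum, v, mul_comm]
    have hu0 : 0 < u := by simpa using hball 0 (norm_zero.trans_le (norm_nonneg z))
    rcases (norm_nonneg z).eq_or_lt with h0 | h0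
    · have := (le_abs_self _).trans (z.le_opNorm (φ ∘L T))
      rw [← h0, zero_mul, hz] at this
      linarith
    have hle : ‖φ ∘L T‖ ≤ u / ‖z‖ := by
      refine ContinuousLinearMap.opNorm_le_bound _ (div_nonneg hu0.le h0.le) fun y => ?_
      rcases (norm_nonneg y).eq_or_lt with hy | hy
      · simp [norm_eq_zero.1 hy.symm]
      have key : ∀ a : ℝ, |a| = ‖z‖ / ‖y‖ → a * φ (T y) < u := fun a ha => by
        have := hball (a • y) (by rw [norm_smul, Real.norm_eq_abs, ha]; field_simp; rfl)
        simpa using this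
      have h1 := key (‖z‖ / ‖y‖) (abs_of_pos (by positivity))
      have h2 := key (-(‖z‖ / ‖y‖)) (by rw [abs_neg]; exact abs_of_pos (by positivity))
      have h3 : ‖z‖ / ‖y‖ * |φ (T y)| ≤ u := by
        rcases abs_cases (φ (T y)) with ⟨h, _⟩ | ⟨h, _⟩ <;> rw [h] <;> linarith
      rw [ContinuousLinearMap.comp_apply, Real.norm_eq_abs]
      calc |φ (T y)| = (‖z‖ / ‖y‖ * |φ (T y)|) * (‖y‖ / ‖z‖) := by field_simp
        _ ≤ u * (‖y‖ / ‖z‖) := mul_le_mul_of_nonneg_right h3 (div_nonneg hy.le h0.le)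
        _ = u / ‖z‖ * ‖y‖ := by ring
    have := (le_abs_self _).trans ((z.le_opNorm (φ ∘L T)).trans
      (mul_le_mul_of_nonneg_left hle (norm_nonneg z)))
    rw [hz, mul_div_cancel₀ _ h0.ne'] at this
    linarith

/-- A functional at distance at least `d` from the annihilator of `K` is large somewhere
on `K`. -/
lemma exists_mem_lt_apply {z : StrongDual ℝ X} {d : ℝ} (hd : 0 < d) (K : Submodule ℝ X)
    (hz : ∀ y : StrongDual ℝ X, (∀ k ∈ K, y k = 0) → d ≤ ‖z - y‖) :
    ∃ k ∈ K, d / 2 * ‖k‖ < |z k| := by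
  by_contra! h
  let r : StrongDual ℝ K := z ∘L K.subtypeL
  have hr : ‖r‖ ≤ d / 2 := r.opNorm_le_bound (by positivity) fun k => h k.1 k.2
  obtain ⟨y, hy, hyn⟩ := exists_extension_norm_eq K r
  have := hz (z - y) fun k hk => by
    have := hy ⟨k, hk⟩
    simp [r] at this
    simp [this]
  rw [sub_sub_cancel, hyn] at this
  linarith

/-- If `z` in the double dual stays at distance at least `d` from the image of the space, then
some functional of norm at most `2 / d` vanishes on a given finite set while `z` takes the
value `1` on it. -/
lemma exists_functional_vanishing {z : StrongDual ℝ (StrongDual ℝ X)} {d : ℝ} (hd : 0 < d)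
    (hz : ∀ x : X, d ≤ ‖z - inclusionInDoubleDual ℝ X x‖) (s : Finset X) :
    ∃ g : StrongDual ℝ X, ‖g‖ ≤ 2 / d ∧ z g = 1 ∧ ∀ x ∈ s, g x = 0 := by
  let J : s → (StrongDual ℝ X →ₗ[ℝ] ℝ) := fun x => (inclusionInDoubleDual ℝ X x.1).toLinearMap
  let K : Submodule ℝ (StrongDual ℝ X) := ⨅ x, LinearMap.ker (J x)
  have hK : ∀ g, g ∈ K ↔ ∀ x ∈ s, g x = 0 := fun g => by
    simp [K, J]
  obtain ⟨k, hkK, hk⟩ := exists_mem_lt_apply hd K (z := z) fun y hy => by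
    have hmem := mem_span_of_iInf_ker_le_ker (L := J) (K := y.toLinearMap) hy
    have hspan : Submodule.span ℝ (Set.range J) ≤
        LinearMap.range ((ContinuousLinearMap.coeLM ℝ : _ →ₗ[ℝ] (StrongDual ℝ X →ₗ[ℝ] ℝ)) ∘ₗ
          (inclusionInDoubleDual ℝ X).toLinearMap) := by
      rw [Submodule.span_le]
      rintro _ ⟨x, rfl⟩
      exact ⟨x.1, rfl⟩
    obtain ⟨x, hx⟩ := hspan hmem
    have hx' : inclusionInDoubleDual ℝ X x = y := by
      ext g
      exact LinearMap.congr_fun hx g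
    rw [← hx']
    exact hz x
  have hne : z k ≠ 0 := by
    intro h0
    rw [h0, abs_zero] at hk
    exact absurd hk (not_lt.2 (by positivity))
  refine ⟨(z k)⁻¹ • k, ?_, by simp [hne], fun x hx => by simp [(hK _).1 hkK x hx]⟩
  rw [norm_smul, norm_inv, inv_mul_le_iff₀ (norm_pos_iff.2 hne), Real.norm_eq_abs]
  calc ‖k‖ = (d / 2 * ‖k‖) * (2 / d) := by field_simp
    _ ≤ |z k| * (2 / d) := by gcongr

/-- A triangular system as in the theorem of James: functionals `f m` with `f m e = 1`, and vectors
`x n` on which `f m` is close to `1` for `m ≤ n` and small for `m > n`. -/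
structure IsTriangularSystem (e : X) (f : ℕ → StrongDual ℝ X) (x : ℕ → X) (C R : ℝ) :
    Prop where
  norm_f_le : ∀ m, ‖f m‖ ≤ C
  norm_x_le : ∀ n, ‖x n‖ ≤ R
  apply_e : ∀ m, f m e = 1
  apply_of_le : ∀ m n, m ≤ n → |f m (x n) - 1| ≤ 1 / ((n : ℝ) + 2)
  apply_of_lt : ∀ m n, n < m → |f m (x n)| ≤ 1 / 2

lemma exists_triangularSystem [CompleteSpace X]
    (h : ¬ Function.Surjective (inclusionInDoubleDual ℝ X)) :
    ∃ (e : X) (f₀ : StrongDual ℝ X) (f : ℕ → StrongDual ℝ X) (x : ℕ → X) (C R : ℝ),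
      f₀ e = 1 ∧ IsTriangularSystem e f x C R := by
  classical
  obtain ⟨z₀, hz₀⟩ : ∃ z₀, ∀ x, inclusionInDoubleDual ℝ X x ≠ z₀ := by
    simpa [Function.Surjective] using h
  obtain ⟨e, he⟩ : ∃ e : X, e ≠ 0 := by
    by_contra! h0
    refine hz₀ 0 ?_
    ext g
    have : g = 0 := by ext x; simp [h0 x]
    simp [this]
  obtain ⟨f₀, hf₀⟩ : ∃ f₀ : StrongDual ℝ X, f₀ e = 1 := SeparatingDual.exists_eq_one he
  set z := z₀ - z₀ f₀ • inclusionInDoubleDual ℝ X e with hzdef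
  have hzf₀ : z f₀ = 0 := by simp [hzdef, hf₀]
  have hcomplete := (inclusionInDoubleDualLi ℝ (E := X)).isometry.isUniformInducing.isComplete_range
  have hclosed : IsClosed (Set.range (inclusionInDoubleDual ℝ X)) := hcomplete.isClosed
  have hznot : z ∉ Set.range (inclusionInDoubleDual ℝ X) := by
    rintro ⟨x, hx⟩
    refine hz₀ (x + z₀ f₀ • e) ?_
    rw [map_add, map_smul, hx, hzdef, sub_add_cancel]
  obtain ⟨d, hd, hball⟩ := exists_le_norm_sub_of_isClosed hclosed hznot
  have hdist : ∀ x : X, d ≤ ‖z - inclusionInDoubleDual ℝ X x‖ := fun x => hball _ ⟨x, rfl⟩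
  let P : ℕ × StrongDual ℝ X × X → Prop := fun p =>
    ‖p.2.1‖ ≤ ‖f₀‖ + 2 / d ∧ ‖p.2.2‖ ≤ ‖z‖ ∧ p.2.1 e = 1 ∧ z p.2.1 = 1 ∧
      |f₀ p.2.2| ≤ 1 / 2 ∧ |p.2.1 p.2.2 - 1| ≤ 1 / ((p.1 : ℝ) + 2)
  let r : ℕ × StrongDual ℝ X × X → ℕ × StrongDual ℝ X × X → Prop := fun p q =>
    p.1 < q.1 ∧ |p.2.1 q.2.2 - 1| ≤ 1 / ((q.1 : ℝ) + 2) ∧ |q.2.1 p.2.2| ≤ 1 / 2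
  obtain ⟨p, hp, hpr⟩ := exists_seq_of_forall_finset_exists P r fun s hs => by
    obtain ⟨g, hg, hzg, hgs⟩ :=
      exists_functional_vanishing hd hdist (insert e (s.image fun p => p.2.2))
    let k : ℕ := s.sup (fun p => p.1) + 1
    let f := f₀ + g
    have hzf : z f = 1 := by simp [f, hzf₀, hzg]
    have hk0 : (0 : ℝ) < 1 / ((k : ℝ) + 2) := by positivity
    have hk : 1 / ((k : ℝ) + 2) ≤ 1 / 2 := by
      gcongr
      linarith [k.cast_nonneg (α := ℝ)]
    obtain ⟨x, hx, hxs⟩ :=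
      exists_approx_doubleDual z (insert f₀ (insert f (s.image fun p => p.2.1))) hk0
    refine ⟨(k, f, x), ⟨?_, hx, ?_, hzf, ?_, ?_⟩, fun p hps => ⟨?_, ?_, ?_⟩⟩
    · exact (norm_add_le _ _).trans (by gcongr)
    · simp [f, hf₀, hgs e (by simp)]
    · have := hxs f₀ (by simp)
      rw [hzf₀, sub_zero] at this
      exact this.le.trans hk
    · have := hxs f (by simp)
      rw [hzf] at this
      exact this.le
    · exact Nat.lt_succ_of_le (Finset.le_sup (f := fun p : ℕ × StrongDual ℝ X × X => p.1) hps)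
    · have := hxs p.2.1 (by
        simp only [Finset.mem_insert, Finset.mem_image]
        exact Or.inr (Or.inr ⟨p, hps, rfl⟩))
      rw [(hs p hps).2.2.2.1] at this
      exact this.le
    · have : g p.2.2 = 0 := hgs _ (by
        simp only [Finset.mem_insert, Finset.mem_image]
        exact Or.inr ⟨p, hps, rfl⟩)
      simpa [f, this] using (hs p hps).2.2.2.2.1
  have hmono : StrictMono fun n => (p n).1 := fun m n hmn => (hpr m n hmn).1
  have hn : ∀ n, 1 / (((p n).1 : ℝ) + 2) ≤ 1 / ((n : ℝ) + 2) := fun n => by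
    have : (n : ℝ) ≤ (p n).1 := by exact_mod_cast hmono.le_apply
    gcongr
  refine ⟨e, f₀, fun n => (p n).2.1, fun n => (p n).2.2, _, _, hf₀, fun m => (hp m).1,
    fun n => (hp n).2.1, fun m => (hp m).2.2.1, fun m n hmn => ?_, fun m n hnm => ?_⟩
  · rcases hmn.eq_or_lt with rfl | hlt
    · exact (hp m).2.2.2.2.2.trans (hn m)
    · exact (hpr m n hlt).2.1.trans (hn n)
  · exact (hpr n m hnm).2.2

end FunctionalAnalysis

section EquivalentNorms

variable {X : Type*} [NormedAddCommGroup X] [NormedSpace ℝ X] {N : X → ℝ}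

namespace IsEquivNorm

lemma nonneg (hN : IsEquivNorm N) (x : X) : 0 ≤ N x := by
  obtain ⟨c, hc, h⟩ := hN.lower
  exact (mul_nonneg hc.le (norm_nonneg x)).trans (h x)

lemma exists_norm_le (hN : IsEquivNorm N) : ∃ K > 0, ∀ x, ‖x‖ ≤ K * N x := by
  obtain ⟨c, hc, h⟩ := hN.lower
  exact ⟨c⁻¹, inv_pos.2 hc, fun x => by rw [inv_mul_eq_div, le_div_iff₀' hc]; exact h x⟩

/-- Every vector of positive norm has a supporting functional. -/
lemma exists_dualSphere_apply_eq (hN : IsEquivNorm N) {v : X} (hv : 0 < N v) :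
    ∃ f : X →L[ℝ] ℝ, DualSphere N f ∧ f v = N v := by
  have hv0 : v ≠ 0 := by
    rintro rfl
    have := hN.smul_eq 0 0
    simp at this
    exact hv.ne' this
  obtain ⟨g, hg, hgN⟩ := exists_extension_of_le_sublinear
    (LinearPMap.mkSpanSingleton v (N v) hv0) N
    (fun a ha x => by rw [hN.smul_eq, abs_of_pos ha]) hN.add_le (by
      rintro ⟨x, hx⟩
      obtain ⟨a, rfl⟩ := Submodule.mem_span_singleton.1 hx
      rw [LinearPMap.mkSpanSingleton'_apply, hN.smul_eq, smul_eq_mul]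
      exact mul_le_mul_of_nonneg_right (le_abs_self a) hv.le)
  have habs : ∀ x, |g x| ≤ N x := fun x => by
    refine abs_le'.2 ⟨hgN x, ?_⟩
    have h1 := hgN ((-1 : ℝ) • x)
    rw [hN.smul_eq, map_smul] at h1
    simpa using h1
  obtain ⟨C, -, hC⟩ := hN.upper
  have hgv : g v = N v := by
    have := hg ⟨v, Submodule.mem_span_singleton_self v⟩
    rw [LinearPMap.mkSpanSingleton_apply] at this
    exact this
  refine ⟨g.mkContinuous C fun x => (habs x).trans (hC x), ⟨habs, fun c hc => ?_⟩, hgv⟩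
  have := hc v
  rw [LinearMap.mkContinuous_apply, hgv, abs_of_pos hv] at this
  exact le_of_mul_le_mul_right (by simpa using this) hv

/-- Normalization of a nonzero functional, with an estimate of the normalizing factor. -/
lemma exists_smul_dualSphere (hN : IsEquivNorm N) {f : X →L[ℝ] ℝ} (hf : f ≠ 0) :
    ∃ t > 0, DualSphere N (t • f) ∧ ∀ c > 0, (∀ x, |f x| ≤ c * N x) → c⁻¹ ≤ t := by
  obtain ⟨K, hK, hKN⟩ := hN.exists_norm_le
  obtain ⟨v, hv⟩ : ∃ v, f v ≠ 0 := by
    by_contra! h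
    exact hf (by ext x; simp [h x])
  let S : Set ℝ := {c | ∀ x, |f x| ≤ c * N x}
  have hNv : 0 < N v := by
    have : v ≠ 0 := by rintro rfl; simp at hv
    have := (norm_pos_iff.2 this).trans_le (hKN v)
    exact pos_of_mul_pos_right this hK.le
  have hlow : ∀ c ∈ S, |f v| / N v ≤ c := fun c hc => by
    rw [div_le_iff₀ hNv]; exact hc v
  have hbdd : BddBelow S := ⟨_, hlow⟩
  have hne : S.Nonempty := ⟨‖f‖ * K, fun x => by
    rw [mul_assoc]
    exact (f.le_opNorm x).trans (mul_le_mul_of_nonneg_left (hKN x) (norm_nonneg _))⟩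
  set ρ := sInf S with hρdef
  have hρ : 0 < ρ := (div_pos (abs_pos.2 hv) hNv).trans_le (le_csInf hne hlow)
  have hρS : ∀ x, |f x| ≤ ρ * N x := fun x => by
    rcases (hN.nonneg x).eq_or_lt with h | h
    · obtain ⟨c, hc⟩ := hne
      have := hc x
      rwa [← h, mul_zero] at this ⊢
    · rw [← div_le_iff₀ h]
      exact le_csInf hne fun c hc => by rw [div_le_iff₀ h]; exact hc x
  refine ⟨ρ⁻¹, inv_pos.2 hρ, ⟨fun x => ?_, fun c hc => ?_⟩, fun c hc h => ?_⟩
  · rw [_root_.smul_apply, smul_eq_mul, abs_mul, abs_of_pos (inv_pos.2 hρ),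
      inv_mul_le_iff₀ hρ]
    exact hρS x
  · have hmem : ρ * c ∈ S := fun x => by
      have := hc x
      rw [_root_.smul_apply, smul_eq_mul, abs_mul, abs_of_pos (inv_pos.2 hρ),
        inv_mul_le_iff₀ hρ] at this
      linarith
    have := csInf_le hbdd hmem
    exact le_of_mul_le_mul_left (by simpa using this) hρ
  · exact inv_anti₀ hρ (csInf_le hbdd h)

end IsEquivNorm

/-- Almost locally uniformly rotund points are nicely strongly exposed. -/
lemma ALURPoint.nsePoint (hN : IsEquivNorm N) {x : X} (hx : N x = 1) (h : ALURPoint N x) :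
    NSEPoint N x := by
  intro f hf hfx xs hxs hlim
  have hNlim : Tendsto (fun n => N (xs n)) atTop (𝓝 1) :=
    tendsto_of_tendsto_of_tendsto_of_le_of_le hlim tendsto_const_nhds
      (fun n => (le_abs_self _).trans (hf.1 _)) hxs
  let ys : ℕ → X := fun n => if N (xs n) = 0 then x else (N (xs n))⁻¹ • xs n
  have hys : ∀ n, N (ys n) = 1 := fun n => by
    by_cases h0 : N (xs n) = 0
    · simp [ys, h0, hx]
    · simp only [ys, h0, if_false]
      rw [hN.smul_eq, abs_of_nonneg (inv_nonneg.2 (hN.nonneg _)), inv_mul_cancel₀ h0]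
  have hev : ∀ᶠ n in atTop, N (xs n) ≠ 0 := hNlim.eventually_ne one_ne_zero
  have hfy : Tendsto (fun n => f (ys n)) atTop (𝓝 1) := by
    have := (hNlim.inv₀ one_ne_zero).mul hlim
    rw [inv_one, one_mul] at this
    refine this.congr' ?_
    filter_upwards [hev] with n hn
    simp [ys, hn]
  have hy : Tendsto ys atTop (𝓝 x) := by
    refine h ys (fun _ => f) (fun _ => 1) hys (fun _ => hf) (fun _ => ?_) tendsto_const_nhds
    have := (hfy.add_const 1).const_mul (2 : ℝ)⁻¹
    norm_num at this
    simpa [hfx, mul_add] using this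
  have := hNlim.smul hy
  rw [one_smul] at this
  refine this.congr' ?_
  filter_upwards [hev] with n hn
  simp [ys, hn]

lemma StronglyExposedBy.exists_delta {x : X} {f : X →L[ℝ] ℝ} (hfN : ∀ z, |f z| ≤ N z)
    (h : StronglyExposedBy N x f) {ε : ℝ} (hε : 0 < ε) :
    ∃ δ > 0, ∀ z, N z ≤ 1 → 1 - δ < f z → dist z x < ε := by
  by_contra! H
  choose z hz1 hz2 hz3 using fun n : ℕ => H (1 / ((n : ℝ) + 1)) (by positivity)
  have hlim : Tendsto (fun n => f (z n)) atTop (𝓝 1) := by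
    have h1 : Tendsto (fun n : ℕ => 1 - 1 / ((n : ℝ) + 1)) atTop (𝓝 1) := by
      simpa using tendsto_one_div_add_atTop_nhds_zero_nat.const_sub (1 : ℝ)
    exact tendsto_of_tendsto_of_tendsto_of_le_of_le h1 tendsto_const_nhds
      (fun n => (hz2 n).le) (fun n => (le_abs_self _).trans ((hfN _).trans (hz1 n)))
  obtain ⟨n, hn⟩ := ((h z hz1 hlim).eventually (Metric.ball_mem_nhds x hε)).exists
  exact absurd hn (not_lt.2 (hz3 n))

/-- In a reflexive space bounded sequences converge weakly along ultrafilters. -/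
lemma exists_weak_limit (h : Function.Surjective (inclusionInDoubleDual ℝ X)) {xs : ℕ → X}
    {B : ℝ} (hB : ∀ n, ‖xs n‖ ≤ B) (U : Ultrafilter ℕ) :
    ∃ y : X, ∀ f : StrongDual ℝ X, Tendsto (fun n => f (xs n)) U (𝓝 (f y)) := by
  let J : ℕ → WeakDual ℝ (StrongDual ℝ X) := fun n =>
    StrongDual.toWeakDual (inclusionInDoubleDual ℝ X (xs n))
  obtain ⟨w, -, hw⟩ := (WeakDual.isCompact_closedBall (0 : StrongDual ℝ (StrongDual ℝ X))
    B).ultrafilter_le_nhds (U.map J) (by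
      simp only [Filter.le_principal_iff, Ultrafilter.mem_coe, Ultrafilter.mem_map]
      refine Filter.Eventually.of_forall (f := (U : Filter ℕ)) fun n => ?_
      refine mem_closedBall_zero_iff.2 ?_
      exact (double_dual_bound ℝ X (xs n)).trans (hB n))
  obtain ⟨y, hy⟩ := h (WeakDual.toStrongDual w)
  refine ⟨y, fun f => ?_⟩
  have hf : f y = w f := by
    rw [← dual_def ℝ X y f, hy]
    rfl
  rw [hf]
  exact ((WeakDual.eval_continuous f).tendsto w).comp hw

/-- In a reflexive space nicely strongly exposed points are almost locally uniformly rotund. -/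
lemma NSEPoint.alurPoint (h : Function.Surjective (inclusionInDoubleDual ℝ X))
    (hN : IsEquivNorm N) {x : X} (hx : N x = 1) (hNSE : NSEPoint N x) : ALURPoint N x := by
  intro xs fs α hxs hfs hα hα1
  obtain ⟨K, hK, hKN⟩ := hN.exists_norm_le
  rw [tendsto_iff_ultrafilter]
  intro U hU
  obtain ⟨y, hy⟩ := exists_weak_limit h (B := K) (fun n => by simpa [hxs n] using hKN (xs n)) U
  have hNy : N y ≤ 1 := by
    rcases (hN.nonneg y).eq_or_lt with h0 | h0
    · rw [← h0]; exact zero_le_one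
    obtain ⟨g, hg, hgy⟩ := hN.exists_dualSphere_apply_eq h0
    rw [← hgy]
    exact le_of_tendsto' (hy g) fun n => (le_abs_self _).trans ((hg.1 _).trans (hxs n).le)
  have hfy : ∀ m, fs m (x + y) = 2 * α m := fun m => by
    have h1 : Tendsto (fun n => fs m ((2 : ℝ)⁻¹ • (xs n + x))) U (𝓝 (2⁻¹ * (fs m y + fs m x))) := by
      simpa [mul_add] using ((hy (fs m)).add_const (fs m x)).const_mul (2 : ℝ)⁻¹
    have := tendsto_nhds_unique h1 ((hα m).mono_left hU)
    rw [map_add]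
    linarith
  have hsum : 2 ≤ N (x + y) := by
    have : Tendsto (fun m => 2 * α m) atTop (𝓝 2) := by simpa using hα1.const_mul 2
    exact le_of_tendsto' this fun m => by
      rw [← hfy m]; exact (le_abs_self _).trans ((hfs m).1 _)
  obtain ⟨g, hg, hgxy⟩ := hN.exists_dualSphere_apply_eq (v := x + y) (by linarith)
  have hgx : g x ≤ 1 := (le_abs_self _).trans ((hg.1 x).trans hx.le)
  have hgy : g y ≤ 1 := (le_abs_self _).trans ((hg.1 y).trans hNy)
  rw [map_add] at hgxy
  have hexp := hNSE g hg (by linarith)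
  have hlim : Tendsto (fun n => g (xs n)) U (𝓝 1) := by
    have := hy g
    rwa [show g y = 1 by linarith] at this
  refine Metric.tendsto_nhds.2 fun ε hε => ?_
  obtain ⟨δ, hδ, hδx⟩ := hexp.exists_delta hg.1 hε
  filter_upwards [hlim.eventually (lt_mem_nhds (show 1 - δ < 1 by linarith))] with n hn
  exact hδx _ (hxs n).le hn

end EquivalentNorms

section Renorming

variable {X : Type*} [NormedAddCommGroup X] [NormedSpace ℝ X]

/-- The seminorm `z ↦ limsup |f m z|` of a sequence of functionals. -/
noncomputable def limsupSeminorm (f : ℕ → StrongDual ℝ X) (z : X) : ℝ :=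
  limsup (fun m => |f m z|) atTop

section limsupSeminorm

variable {f : ℕ → StrongDual ℝ X} {C : ℝ}

lemma abs_apply_le (hf : ∀ m, ‖f m‖ ≤ C) (m : ℕ) (z : X) : |f m z| ≤ C * ‖z‖ :=
  ((f m).le_opNorm z).trans (mul_le_mul_of_nonneg_right (hf m) (norm_nonneg z))

lemma limsupSeminorm_le_iff (hf : ∀ m, ‖f m‖ ≤ C) {z : X} {a : ℝ} :
    limsupSeminorm f z ≤ a ↔ ∀ b > a, ∀ᶠ m in atTop, |f m z| < b := by
  refine limsup_le_iff ?_ ?_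
  · exact (isBoundedUnder_of ⟨0, fun m => abs_nonneg (f m z)⟩).isCoboundedUnder_le
  · exact isBoundedUnder_of ⟨_, fun m => abs_apply_le hf m z⟩

lemma eventually_lt_of_limsupSeminorm_lt (hf : ∀ m, ‖f m‖ ≤ C) {z : X} {b : ℝ}
    (h : limsupSeminorm f z < b) : ∀ᶠ m in atTop, |f m z| < b :=
  (limsupSeminorm_le_iff hf).1 le_rfl b h

lemma limsupSeminorm_nonneg (hf : ∀ m, ‖f m‖ ≤ C) (z : X) : 0 ≤ limsupSeminorm f z := by
  by_contra! h
  obtain ⟨m, hm⟩ := (eventually_lt_of_limsupSeminorm_lt hf h).exists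
  exact absurd hm (not_lt.2 (abs_nonneg _))

lemma limsupSeminorm_add_le (hf : ∀ m, ‖f m‖ ≤ C) (x y : X) :
    limsupSeminorm f (x + y) ≤ limsupSeminorm f x + limsupSeminorm f y := by
  refine (limsupSeminorm_le_iff hf).2 fun b hb => ?_
  have hη : 0 < (b - (limsupSeminorm f x + limsupSeminorm f y)) / 2 := by linarith
  filter_upwards [eventually_lt_of_limsupSeminorm_lt hf (z := x) (lt_add_of_pos_right _ hη),
    eventually_lt_of_limsupSeminorm_lt hf (z := y) (lt_add_of_pos_right _ hη)] with m h1 h2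
  rw [map_add]
  linarith [abs_add_le (f m x) (f m y)]

lemma limsupSeminorm_smul_le (hf : ∀ m, ‖f m‖ ≤ C) (a : ℝ) (x : X) :
    limsupSeminorm f (a • x) ≤ |a| * limsupSeminorm f x := by
  refine (limsupSeminorm_le_iff hf).2 fun b hb => ?_
  rcases eq_or_ne a 0 with rfl | ha
  · refine Eventually.of_forall fun m => ?_
    simpa using hb
  · have ha' := abs_pos.2 ha
    filter_upwards [eventually_lt_of_limsupSeminorm_lt hf ((lt_div_iff₀' ha').2 hb)] with m hm
    rw [map_smul, smul_eq_mul, abs_mul]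
    exact (lt_div_iff₀' ha').1 hm

lemma limsupSeminorm_smul (hf : ∀ m, ‖f m‖ ≤ C) (a : ℝ) (x : X) :
    limsupSeminorm f (a • x) = |a| * limsupSeminorm f x := by
  refine (limsupSeminorm_smul_le hf a x).antisymm ?_
  rcases eq_or_ne a 0 with rfl | ha
  · simpa using limsupSeminorm_nonneg hf 0
  · have := limsupSeminorm_smul_le hf a⁻¹ (a • x)
    rwa [inv_smul_smul₀ ha, abs_inv, ← div_eq_inv_mul, le_div_iff₀' (abs_pos.2 ha)] at this

lemma limsupSeminorm_le (hf : ∀ m, ‖f m‖ ≤ C) (z : X) : limsupSeminorm f z ≤ C * ‖z‖ :=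
  (limsupSeminorm_le_iff hf).2 fun _ hb =>
    Eventually.of_forall fun m => (abs_apply_le hf m z).trans_lt hb

end limsupSeminorm

/-- The weights `1 - 1 / (m + 2)`, which increase to `1`. -/
noncomputable def weight (m : ℕ) : ℝ := 1 - 1 / ((m : ℝ) + 2)

lemma weight_pos (m : ℕ) : 0 < weight m := by
  rw [weight, sub_pos, div_lt_one (by positivity)]
  linarith [m.cast_nonneg (α := ℝ)]

lemma weight_lt_one (m : ℕ) : weight m < 1 := by
  have : (0 : ℝ) < 1 / ((m : ℝ) + 2) := by positivity
  rw [weight]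
  linarith

lemma weight_mono : Monotone weight := fun m n h => by
  unfold weight
  gcongr

lemma tendsto_one_div_add_two : Tendsto (fun n : ℕ => 1 / ((n : ℝ) + 2)) atTop (𝓝 0) :=
  tendsto_const_nhds.div_atTop
    (tendsto_atTop_add_const_right _ _ tendsto_natCast_atTop_atTop)

lemma tendsto_weight : Tendsto weight atTop (𝓝 1) := by
  have h := tendsto_one_div_add_two.const_sub (1 : ℝ)
  rwa [sub_zero] at h

/-- The supremum of the weighted functionals. -/
noncomputable def weightedSup (f : ℕ → StrongDual ℝ X) (z : X) : ℝ :=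
  ⨆ m, weight m * |f m z|

/-- Distance of `z` to its projection on the line of `e` along the kernel of `f₀`. -/
noncomputable def lineResidual (f₀ : StrongDual ℝ X) (e z : X) : ℝ := ‖z - f₀ z • e‖

/-- The Euclidean combination of `limsupSeminorm` and a multiple of `lineResidual`. -/
noncomputable def roundSeminorm (f₀ : StrongDual ℝ X) (e : X) (f : ℕ → StrongDual ℝ X) (c : ℝ)
    (z : X) : ℝ :=
  √(limsupSeminorm f z ^ 2 + (c * lineResidual f₀ e z) ^ 2)

/-- The renorming attached to a triangular system. -/
noncomputable def triangularNorm (f₀ : StrongDual ℝ X) (e : X) (f : ℕ → StrongDual ℝ X) (c : ℝ)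
    (z : X) : ℝ :=
  max (roundSeminorm f₀ e f c z) (weightedSup f z)

variable {f₀ : StrongDual ℝ X} {e : X} {f : ℕ → StrongDual ℝ X} {C c : ℝ}

lemma lineResidual_nonneg (f₀ : StrongDual ℝ X) (e z : X) : 0 ≤ lineResidual f₀ e z := norm_nonneg _

lemma lineResidual_add_le (x y : X) :
    lineResidual f₀ e (x + y) ≤ lineResidual f₀ e x + lineResidual f₀ e y := by
  refine le_of_eq_of_le ?_ (norm_add_le _ _)
  rw [lineResidual, map_add, add_smul]
  congr 1
  abel

lemma lineResidual_smul (a : ℝ) (x : X) :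
    lineResidual f₀ e (a • x) = |a| * lineResidual f₀ e x := by
  rw [lineResidual, lineResidual, ← Real.norm_eq_abs, ← norm_smul, smul_sub, map_smul, smul_assoc]

lemma lineResidual_le (z : X) : lineResidual f₀ e z ≤ (1 + ‖f₀‖ * ‖e‖) * ‖z‖ := by
  calc lineResidual f₀ e z ≤ ‖z‖ + ‖f₀ z • e‖ := norm_sub_le _ _
    _ ≤ ‖z‖ + ‖f₀‖ * ‖z‖ * ‖e‖ := by
      rw [norm_smul]
      gcongr
      exact f₀.le_opNorm z
    _ = (1 + ‖f₀‖ * ‖e‖) * ‖z‖ := by ring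

lemma lineResidual_self (he : f₀ e = 1) : lineResidual f₀ e e = 0 := by simp [lineResidual, he]

lemma sqrt_add_sq_add_le {a b p q u v : ℝ} (ha : 0 ≤ u) (hb : 0 ≤ v) (hu : u ≤ a + p)
    (hv : v ≤ b + q) : √(u ^ 2 + v ^ 2) ≤ √(a ^ 2 + b ^ 2) + √(p ^ 2 + q ^ 2) := by
  have h := norm_add_le (⟨a, b⟩ : ℂ) ⟨p, q⟩
  simp only [Complex.norm_eq_sqrt_sq_add_sq, Complex.add_re, Complex.add_im] at h
  refine le_trans ?_ h
  gcongr

lemma roundSeminorm_add_le (hf : ∀ m, ‖f m‖ ≤ C) (hc : 0 ≤ c) (x y : X) :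
    roundSeminorm f₀ e f c (x + y) ≤ roundSeminorm f₀ e f c x + roundSeminorm f₀ e f c y := by
  refine sqrt_add_sq_add_le (limsupSeminorm_nonneg hf _)
    (mul_nonneg hc (lineResidual_nonneg _ _ _)) (limsupSeminorm_add_le hf x y) ?_
  rw [← mul_add]
  exact mul_le_mul_of_nonneg_left (lineResidual_add_le x y) hc

lemma roundSeminorm_smul (hf : ∀ m, ‖f m‖ ≤ C) (a : ℝ) (x : X) :
    roundSeminorm f₀ e f c (a • x) = |a| * roundSeminorm f₀ e f c x := by
  rw [roundSeminorm, roundSeminorm, limsupSeminorm_smul hf, lineResidual_smul]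
  rw [show (|a| * limsupSeminorm f x) ^ 2 + (c * (|a| * lineResidual f₀ e x)) ^ 2 =
    |a| ^ 2 * (limsupSeminorm f x ^ 2 + (c * lineResidual f₀ e x) ^ 2) by ring,
    Real.sqrt_mul (by positivity), Real.sqrt_sq (abs_nonneg a)]

lemma limsupSeminorm_le_roundSeminorm (z : X) : limsupSeminorm f z ≤ roundSeminorm f₀ e f c z :=
  Real.le_sqrt_of_sq_le (by nlinarith [sq_nonneg (c * lineResidual f₀ e z)])

lemma lineResidual_le_roundSeminorm (z : X) : c * lineResidual f₀ e z ≤ roundSeminorm f₀ e f c z :=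
  Real.le_sqrt_of_sq_le (by nlinarith [sq_nonneg (limsupSeminorm f z)])

lemma roundSeminorm_le_add (hf : ∀ m, ‖f m‖ ≤ C) (hc : 0 ≤ c) (z : X) :
    roundSeminorm f₀ e f c z ≤ limsupSeminorm f z + c * lineResidual f₀ e z := by
  have h1 := limsupSeminorm_nonneg hf z
  have h2 := mul_nonneg hc (lineResidual_nonneg f₀ e z)
  exact Real.sqrt_le_iff.2 ⟨by positivity, by nlinarith⟩

lemma weight_mul_abs_le (m : ℕ) (z : X) : weight m * |f m z| ≤ |f m z| :=
  mul_le_of_le_one_left (abs_nonneg _) (weight_lt_one m).le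

lemma le_weightedSup (hf : ∀ m, ‖f m‖ ≤ C) (m : ℕ) (z : X) :
    weight m * |f m z| ≤ weightedSup f z :=
  le_ciSup (f := fun m => weight m * |f m z|)
    ⟨C * ‖z‖, by rintro _ ⟨m, rfl⟩; exact (weight_mul_abs_le m z).trans (abs_apply_le hf m z)⟩ m

lemma weightedSup_add_le (hf : ∀ m, ‖f m‖ ≤ C) (x y : X) :
    weightedSup f (x + y) ≤ weightedSup f x + weightedSup f y := by
  refine ciSup_le fun m => ?_
  refine le_trans ?_ (add_le_add (le_weightedSup hf m x) (le_weightedSup hf m y))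
  rw [← mul_add, map_add]
  exact mul_le_mul_of_nonneg_left (abs_add_le _ _) (weight_pos m).le

lemma weightedSup_smul (a : ℝ) (x : X) : weightedSup f (a • x) = |a| * weightedSup f x := by
  rw [weightedSup, weightedSup, Real.mul_iSup_of_nonneg (abs_nonneg a)]
  congr 1
  ext m
  rw [map_smul, smul_eq_mul, abs_mul]
  ring

lemma limsupSeminorm_le_triangularNorm (z : X) :
    limsupSeminorm f z ≤ triangularNorm f₀ e f c z :=
  (limsupSeminorm_le_roundSeminorm z).trans (le_max_left _ _)

lemma lineResidual_le_triangularNorm (z : X) :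
    c * lineResidual f₀ e z ≤ triangularNorm f₀ e f c z :=
  (lineResidual_le_roundSeminorm z).trans (le_max_left _ _)

lemma weight_mul_le_triangularNorm (hf : ∀ m, ‖f m‖ ≤ C) (m : ℕ) (z : X) :
    weight m * |f m z| ≤ triangularNorm f₀ e f c z :=
  (le_weightedSup hf m z).trans (le_max_right _ _)

lemma isEquivNorm_triangularNorm (hf : ∀ m, ‖f m‖ ≤ C) (hfe : ∀ m, f m e = 1) (hc : 0 < c) :
    IsEquivNorm (triangularNorm f₀ e f c) where
  add_le x y := max_le
    ((roundSeminorm_add_le hf hc.le x y).trans (add_le_add (le_max_left _ _) (le_max_left _ _)))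
    ((weightedSup_add_le hf x y).trans (add_le_add (le_max_right _ _) (le_max_right _ _)))
  smul_eq a x := by
    rw [triangularNorm, triangularNorm, roundSeminorm_smul hf, weightedSup_smul,
      mul_max_of_nonneg _ _ (abs_nonneg a)]
  lower := by
    have hC : 0 ≤ C := (norm_nonneg _).trans (hf 0)
    refine ⟨((1 + C * c⁻¹) * ‖e‖ + c⁻¹)⁻¹, by positivity, fun z => ?_⟩
    rw [inv_mul_le_iff₀ (by positivity)]
    have h1 : lineResidual f₀ e z ≤ c⁻¹ * triangularNorm f₀ e f c z := by
      rw [le_inv_mul_iff₀ hc]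
      exact lineResidual_le_triangularNorm z
    have h2 : |f₀ z| ≤ limsupSeminorm f z + C * lineResidual f₀ e z := by
      rw [← sub_le_iff_le_add]
      refine le_of_forall_gt fun b hb => ?_
      obtain ⟨m, hm⟩ := (eventually_lt_of_limsupSeminorm_lt hf hb).exists
      have h3 : f₀ z = f m z - f m (z - f₀ z • e) := by simp [hfe m]
      have h4 : |f m (z - f₀ z • e)| ≤ C * lineResidual f₀ e z := abs_apply_le hf m _
      have h5 := abs_sub (f m z) (f m (z - f₀ z • e))
      rw [← h3] at h5
      linarith
    have h3 : ‖z‖ ≤ |f₀ z| * ‖e‖ + lineResidual f₀ e z := by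
      rw [← Real.norm_eq_abs, ← norm_smul]
      refine le_of_eq_of_le ?_ (norm_add_le _ _)
      rw [add_sub_cancel]
    calc ‖z‖ ≤ |f₀ z| * ‖e‖ + lineResidual f₀ e z := h3
      _ ≤ (triangularNorm f₀ e f c z + C * (c⁻¹ * triangularNorm f₀ e f c z)) * ‖e‖ +
          c⁻¹ * triangularNorm f₀ e f c z := by
        gcongr
        exact h2.trans (add_le_add (limsupSeminorm_le_triangularNorm z)
          (mul_le_mul_of_nonneg_left h1 hC))
      _ = _ := by ring
  upper := by
    have hC : 0 ≤ C := (norm_nonneg _).trans (hf 0)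
    refine ⟨C + c * (1 + ‖f₀‖ * ‖e‖), by positivity, fun z => max_le ?_ ?_⟩
    · refine (roundSeminorm_le_add hf hc.le z).trans ?_
      rw [add_mul, mul_assoc]
      exact add_le_add (limsupSeminorm_le hf z)
        (mul_le_mul_of_nonneg_left (lineResidual_le z) hc.le)
    · refine ciSup_le fun m => ((weight_mul_abs_le m z).trans (abs_apply_le hf m z)).trans ?_
      gcongr
      exact le_add_of_nonneg_right (by positivity)

lemma limsupSeminorm_self (hfe : ∀ m, f m e = 1) : limsupSeminorm f e = 1 := by
  simp [limsupSeminorm, hfe]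

lemma triangularNorm_self (hfe : ∀ m, f m e = 1) (he : f₀ e = 1) :
    triangularNorm f₀ e f c e = 1 := by
  rw [triangularNorm, roundSeminorm, limsupSeminorm_self hfe, lineResidual_self he]
  norm_num
  exact ciSup_le fun m => (weight_mul_abs_le m e).trans (by simp [hfe])

/-- Supporting functionals at `e` are dominated by `limsupSeminorm`. -/
lemma apply_le_limsupSeminorm (hf : ∀ m, ‖f m‖ ≤ C) (hfe : ∀ m, f m e = 1) (he : f₀ e = 1)
    (hc : 0 < c) {g : StrongDual ℝ X} (hg : ∀ z, |g z| ≤ triangularNorm f₀ e f c z)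
    (hge : g e = 1) (h : X) : g h ≤ limsupSeminorm f h := by
  by_contra! hlt
  obtain ⟨b, hqb, hb⟩ := exists_between hlt
  obtain ⟨M, hM⟩ := eventually_atTop.1 (eventually_lt_of_limsupSeminorm_lt hf hqb)
  have hq := limsupSeminorm_nonneg hf h
  have ev1 : ∀ᶠ s in 𝓝[>] (0 : ℝ),
      s * (c * lineResidual f₀ e h) ^ 2 < 2 * (g h - limsupSeminorm f h) := by
    have : Tendsto (fun s : ℝ => s * (c * lineResidual f₀ e h) ^ 2) (𝓝[>] 0) (𝓝 0) := by
      have : Tendsto (fun s : ℝ => s * (c * lineResidual f₀ e h) ^ 2) (𝓝 0)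
        (𝓝 (0 * (c * lineResidual f₀ e h) ^ 2)) := (continuous_id.mul continuous_const).tendsto 0
      rw [zero_mul] at this
      exact this.mono_left nhdsWithin_le_nhds
    exact this.eventually (gt_mem_nhds (by linarith))
  have ev2 : ∀ᶠ s in 𝓝[>] (0 : ℝ), weight M * (1 + s * |C * ‖h‖|) < 1 := by
    have : Tendsto (fun s : ℝ => weight M * (1 + s * |C * ‖h‖|)) (𝓝 0)
        (𝓝 (weight M * (1 + 0 * |C * ‖h‖|))) :=
      (continuous_const.mul (continuous_const.add (continuous_id.mul continuous_const))).tendsto 0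
    rw [zero_mul, add_zero, mul_one] at this
    exact (this.mono_left nhdsWithin_le_nhds).eventually (gt_mem_nhds (weight_lt_one M))
  obtain ⟨s, ⟨h1, h2⟩, hs⟩ := ((ev1.and ev2).and self_mem_nhdsWithin).exists
  have hs0 : 0 < s := hs
  have hlow : 1 + s * g h ≤ triangularNorm f₀ e f c (e + s • h) := by
    refine le_trans ?_ (hg _)
    refine le_of_eq_of_le ?_ (le_abs_self _)
    simp [hge]
  refine absurd hlow (not_le.2 (max_lt ?_ ?_))
  · have hqs : limsupSeminorm f (e + s • h) ≤ 1 + s * limsupSeminorm f h := by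
      refine (limsupSeminorm_add_le hf _ _).trans ?_
      rw [limsupSeminorm_self hfe, limsupSeminorm_smul hf, abs_of_pos hs0]
    have hrs : lineResidual f₀ e (e + s • h) ≤ s * lineResidual f₀ e h := by
      refine (lineResidual_add_le _ _).trans ?_
      rw [lineResidual_self he, lineResidual_smul, abs_of_pos hs0, zero_add]
    have hgh : 0 < g h := hq.trans_lt hlt
    rw [roundSeminorm, Real.sqrt_lt' (by positivity)]
    have e1 : limsupSeminorm f (e + s • h) ^ 2 ≤ (1 + s * limsupSeminorm f h) ^ 2 := by
      gcongr
      exact limsupSeminorm_nonneg hf _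
    have e2 : (c * lineResidual f₀ e (e + s • h)) ^ 2 ≤ (c * (s * lineResidual f₀ e h)) ^ 2 := by
      have := lineResidual_nonneg f₀ e (e + s • h)
      gcongr
    have e3 := mul_lt_mul_of_pos_left h1 hs0
    have e4 : (s * limsupSeminorm f h) ^ 2 ≤ (s * g h) ^ 2 := by gcongr
    nlinarith
  · refine (ciSup_le (c := 1 + s * b) fun m => ?_).trans_lt (by nlinarith)
    have hm : |f m (e + s • h)| ≤ 1 + s * |f m h| := by
      rw [map_add, map_smul, hfe, smul_eq_mul]
      refine (abs_add_le _ _).trans ?_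
      rw [abs_one, abs_mul, abs_of_pos hs0]
    rcases le_total M m with hMm | hmM
    · refine (weight_mul_abs_le m _).trans (hm.trans ?_)
      gcongr
      exact (hM m hMm).le
    · have hb0 : 0 ≤ s * b := mul_nonneg hs0.le (hq.trans hqb.le)
      calc weight m * |f m (e + s • h)| ≤ weight M * (1 + s * |C * ‖h‖|) := by
            have := (weight_pos M).le
            refine mul_le_mul (weight_mono hmM) (hm.trans ?_) (abs_nonneg _) this
            gcongr 1 + s * ?_
            exact (abs_apply_le hf m h).trans (le_abs_self _)
        _ ≤ 1 + s * b := by linarith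

lemma nsePoint_triangularNorm (hf : ∀ m, ‖f m‖ ≤ C) (hfe : ∀ m, f m e = 1) (he : f₀ e = 1)
    (hc : 0 < c) : NSEPoint (triangularNorm f₀ e f c) e := by
  intro g hg hge xs hxs hlim
  have hgq := apply_le_limsupSeminorm hf hfe he hc hg.1 hge
  have hres : Tendsto (fun n => c * lineResidual f₀ e (xs n)) atTop (𝓝 0) := by
    have hsq : Tendsto (fun n => √(1 - g (xs n) ^ 2)) atTop (𝓝 0) := by
      have := ((hlim.pow 2).const_sub 1).sqrt
      simpa using this
    refine squeeze_zero' (Eventually.of_forall fun n =>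
      mul_nonneg hc.le (lineResidual_nonneg _ _ _)) ?_ hsq
    filter_upwards [hlim.eventually (lt_mem_nhds one_pos)] with n hn
    refine Real.le_sqrt_of_sq_le ?_
    have h1 := (le_max_left _ _).trans (hxs n)
    rw [roundSeminorm, Real.sqrt_le_iff] at h1
    have h2 := pow_le_pow_left₀ hn.le (hgq (xs n)) 2
    linarith [h1.2]
  have hsub : Tendsto (fun n => xs n - f₀ (xs n) • e) atTop (𝓝 0) := by
    rw [tendsto_zero_iff_norm_tendsto_zero]
    have := hres.const_mul c⁻¹
    simpa [hc.ne', lineResidual] using this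
  have hf₀ : Tendsto (fun n => f₀ (xs n)) atTop (𝓝 1) := by
    have h1 := hlim.sub ((g.continuous.tendsto 0).comp hsub)
    simpa [hge] using h1
  simpa using hsub.add (hf₀.smul_const e)

lemma IsTriangularSystem.exists_not_alurPoint {x : ℕ → X} {R : ℝ}
    (h : IsTriangularSystem e f x C R) (he : f₀ e = 1) :
    ∃ c > 0, ¬ ALURPoint (triangularNorm f₀ e f c) e := by
  have hR : 0 ≤ R := (norm_nonneg _).trans (h.norm_x_le 0)
  have hf := h.norm_f_le
  set L := (1 + ‖f₀‖ * ‖e‖) * R with hL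
  have hL0 : 0 ≤ L := by positivity
  obtain ⟨c, hc, hcL⟩ : ∃ c > 0, c * L ≤ 1 / 2 := by
    refine ⟨1 / (2 * (L + 1)), by positivity, ?_⟩
    rw [div_mul_eq_mul_div, div_le_div_iff₀ (by positivity) (by norm_num)]
    linarith
  refine ⟨c, hc, fun hal => ?_⟩
  set N := triangularNorm f₀ e f c with hNdef
  have hN : IsEquivNorm N := isEquivNorm_triangularNorm hf h.apply_e hc
  have hNe : N e = 1 := triangularNorm_self h.apply_e he
  have hupper : ∀ n, N (x n) ≤ 1 + 1 / ((n : ℝ) + 2) := fun n => by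
    have hn : (0 : ℝ) < 1 / ((n : ℝ) + 2) := by positivity
    refine max_le ?_ (ciSup_le fun m => (weight_mul_abs_le m _).trans ?_)
    · refine (roundSeminorm_le_add hf hc.le _).trans ?_
      have h1 : limsupSeminorm f (x n) ≤ 1 / 2 := by
        refine (limsupSeminorm_le_iff hf).2 fun b hb => ?_
        filter_upwards [eventually_gt_atTop n] with m hm
        exact (h.apply_of_lt m n hm).trans_lt hb
      have h2 : c * lineResidual f₀ e (x n) ≤ c * L := by
        refine mul_le_mul_of_nonneg_left ((lineResidual_le _).trans ?_) hc.le
        exact mul_le_mul_of_nonneg_left (h.norm_x_le n) (by positivity)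
      linarith
    · rcases le_or_gt m n with hmn | hmn
      · have := h.apply_of_le m n hmn
        have h3 := abs_add_le (f m (x n) - 1) 1
        rw [sub_add_cancel, abs_one] at h3
        linarith
      · linarith [h.apply_of_lt m n hmn]
  have hlower : ∀ n, weight n * weight n ≤ N (x n) := fun n => by
    refine le_trans ?_ (weight_mul_le_triangularNorm hf n (x n))
    refine mul_le_mul_of_nonneg_left ?_ (weight_pos n).le
    have := neg_le_of_abs_le (h.apply_of_le n n le_rfl)
    exact le_trans (by rw [weight]; linarith) (le_abs_self _)
  have hpos : ∀ n, 0 < N (x n) := fun n =>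
    (mul_pos (weight_pos n) (weight_pos n)).trans_le (hlower n)
  have hNlim : Tendsto (fun n => N (x n)) atTop (𝓝 1) := by
    refine tendsto_of_tendsto_of_tendsto_of_le_of_le ?_ ?_ hlower hupper
    · simpa using tendsto_weight.mul tendsto_weight
    · simpa using tendsto_one_div_add_two.const_add (1 : ℝ)
  have hfne : ∀ m, f m ≠ 0 := fun m h0 => by
    have := h.apply_e m
    simp [h0] at this
  choose t ht hts htc using fun m => hN.exists_smul_dualSphere (hfne m)
  have htlim : Tendsto t atTop (𝓝 1) := by
    refine tendsto_of_tendsto_of_tendsto_of_le_of_le tendsto_weight tendsto_const_nhds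
      (fun m => ?_) fun m => ?_
    · have := htc m (weight m)⁻¹ (inv_pos.2 (weight_pos m)) fun z => by
        rw [le_inv_mul_iff₀ (weight_pos m)]
        exact weight_mul_le_triangularNorm hf m z
      rwa [inv_inv] at this
    · have := (le_abs_self _).trans ((hts m).1 e)
      simpa [h.apply_e, hNe] using this
  have happ : ∀ m, Tendsto (fun n => f m (x n)) atTop (𝓝 1) := fun m => by
    rw [tendsto_iff_norm_sub_tendsto_zero]
    refine squeeze_zero' (Eventually.of_forall fun n => norm_nonneg _) ?_ tendsto_one_div_add_two
    filter_upwards [eventually_ge_atTop m] with n hn using h.apply_of_le m n hn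
  have hy : Tendsto (fun n => (N (x n))⁻¹ • x n) atTop (𝓝 e) := by
    refine hal _ (fun m => t m • f m) t (fun n => ?_) hts (fun m => ?_) htlim
    · rw [hN.smul_eq, abs_of_pos (inv_pos.2 (hpos n)), inv_mul_cancel₀ (hpos n).ne']
    · have h1 := (((hNlim.inv₀ one_ne_zero).mul (happ m)).add_const 1).const_mul (t m * 2⁻¹)
      have h2 : t m * 2⁻¹ * ((1 : ℝ)⁻¹ * 1 + 1) = t m := by ring
      rw [h2] at h1
      refine h1.congr fun n => ?_
      simp only [_root_.smul_apply, map_smul, map_add, smul_eq_mul, h.apply_e]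
      ring
  have hx : Tendsto x atTop (𝓝 e) := by
    have := hNlim.smul hy
    rw [one_smul] at this
    refine this.congr fun n => ?_
    rw [smul_inv_smul₀ (hpos n).ne']
  have hC : Tendsto (fun n => C * ‖x n - e‖) atTop (𝓝 0) := by
    simpa using (tendsto_iff_norm_sub_tendsto_zero.1 hx).const_mul C
  obtain ⟨n, hn⟩ := (hC.eventually (gt_mem_nhds (show (0 : ℝ) < 1 / 2 by norm_num))).exists
  have h1 := abs_apply_le hf (n + 1) (x n - e)
  rw [map_sub, h.apply_e] at h1
  have h2 := neg_le_of_abs_le h1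
  have h3 := (le_abs_self _).trans (h.apply_of_lt (n + 1) n n.lt_succ_self)
  linarith

end Renorming

/-- A Banach space `X` is reflexive if and only if for every equivalent norm `N` on `X`
the set of aLUR points of the `N`-unit sphere coincides with the set of NSE points of the
`N`-unit sphere. -/
theorem reflexive_iff_aLUR_eq_NSE {X : Type*} [NormedAddCommGroup X] [NormedSpace ℝ X]
    [CompleteSpace X] :
    Function.Surjective ⇑(inclusionInDoubleDual ℝ X) ↔
      ∀ N : X → ℝ, IsEquivNorm N →
        {x : X | N x = 1 ∧ ALURPoint N x} = {x : X | N x = 1 ∧ NSEPoint N x} := by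
  refine ⟨fun h N hN => Set.ext fun x => and_congr_right fun hx =>
    ⟨fun hal => hal.nsePoint hN hx, fun hnse => hnse.alurPoint h hN hx⟩, fun h => ?_⟩
  by_contra hns
  obtain ⟨e, f₀, f, x, C, R, he, hsys⟩ := exists_triangularSystem hns
  obtain ⟨c, hc, hnot⟩ := hsys.exists_not_alurPoint he
  have hmem : e ∈ {x : X | triangularNorm f₀ e f c x = 1 ∧ NSEPoint (triangularNorm f₀ e f c) x} :=
    ⟨triangularNorm_self hsys.apply_e he,
      nsePoint_triangularNorm hsys.norm_f_le hsys.apply_e he hc⟩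
  rw [← h _ (isEquivNorm_triangularNorm hsys.norm_f_le hsys.apply_e hc)] at hmem
  exact hnot hmem.2
end

section
/- Let X be a non-reflexive real Banach space. Then X admits a norm |||·||| equivalent to its original norm such that there exists a point x ∈ S_{(X,|||·|||)} which is a nicely strongly exposed (NSE) point of S_{(X,|||·|||)} but is not a weakly almost locally uniformly rotund (w-aLUR) point of S_{(X,|||·|||)}. -/
open Filter Topology NormedSpace

/-- `x` is a weakly almost locally uniformly rotund (w-aLUR) point of the unit sphere of
`(Z, N)`: under the aLUR double-limit condition the sequence converges weakly to `x`. -/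
def WALURPoint {Z : Type*} [NormedAddCommGroup Z] [NormedSpace ℝ Z]
    (N : Z → ℝ) (x : Z) : Prop :=
  ∀ (xs : ℕ → Z) (fs : ℕ → Z →L[ℝ] ℝ) (α : ℕ → ℝ),
    (∀ n, N (xs n) = 1) → (∀ m, DualSphere N (fs m)) →
    (∀ m, Tendsto (fun n => fs m ((2 : ℝ)⁻¹ • (xs n + x))) atTop (𝓝 (α m))) →
    Tendsto α atTop (𝓝 1) →
    ∀ g : Z →L[ℝ] ℝ, Tendsto (fun n => g (xs n)) atTop (𝓝 (g x))

/-- **Helly's theorem** on moment problems: an element of the bidual agrees on finitely many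
functionals with some vector of controlled norm. -/
theorem exists_norm_le_forall_eq_bidual {E : Type*} [NormedAddCommGroup E] [NormedSpace ℝ E]
    (G : StrongDual ℝ (StrongDual ℝ E)) (s : Finset (StrongDual ℝ E)) :
    ∃ x : E, ‖x‖ ≤ ‖G‖ + 1 ∧ ∀ f ∈ s, f x = G f := by
  classical
  obtain ⟨x₀, hx₀⟩ : ∃ x₀ : E, ∀ f ∈ s, f x₀ = G f := by
    let T : E →ₗ[ℝ] (s → ℝ) := LinearMap.pi fun f => (f.1 : E →ₗ[ℝ] ℝ)
    suffices hv : (fun f : s => G f.1) ∈ LinearMap.range T by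
      obtain ⟨x₀, hx₀⟩ := hv
      exact ⟨x₀, fun f hf => congrFun hx₀ ⟨f, hf⟩⟩
    by_contra hv
    obtain ⟨a, ha, hle⟩ := Submodule.exists_le_ker_of_notMem hv
    apply ha
    have hsum : ∀ w : s → ℝ, a w = ∑ i, w i * a (fun j => if i = j then 1 else 0) :=
      LinearMap.pi_apply_eq_sum_univ a
    have hz : ∑ i : s, a (fun j => if i = j then 1 else 0) • i.1 = 0 := by
      ext x
      have := hle (LinearMap.mem_range_self T x)
      rw [LinearMap.mem_ker, hsum] at this
      simpa [T, mul_comm] using this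
    rw [hsum]
    simpa [mul_comm] using congrArg G hz
  let V : Submodule ℝ E := ⨅ f : s, LinearMap.ker (f.1 : E →ₗ[ℝ] ℝ)
  have hV : ∀ y ∈ V, ∀ f ∈ s, f y = 0 := fun y hy f hf => by
    simpa using (Submodule.mem_iInf _).1 hy ⟨f, hf⟩
  have hnorm : ‖(Submodule.Quotient.mk x₀ : E ⧸ V)‖ ≤ ‖G‖ := by
    obtain ⟨k, hk, hkx⟩ := exists_dual_vector'' ℝ (Submodule.Quotient.mk x₀ : E ⧸ V)
    let f : StrongDual ℝ E := k.comp V.mkQL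
    have hf : ‖f‖ ≤ 1 := f.opNorm_le_bound zero_le_one fun x => by
      calc ‖k (V.mkQL x)‖ ≤ ‖k‖ * ‖V.mkQL x‖ := k.le_opNorm _
        _ ≤ 1 * ‖x‖ := by
          gcongr
          exact Submodule.Quotient.norm_mk_le V x
    have hspan : (f : E →ₗ[ℝ] ℝ) ∈ Submodule.span ℝ
        (Set.range fun i : s => (i.1 : E →ₗ[ℝ] ℝ)) := by
      apply mem_span_of_iInf_ker_le_ker
      intro y hy
      have hy0 : (Submodule.Quotient.mk y : E ⧸ V) = 0 := (Submodule.Quotient.mk_eq_zero V).2 hy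
      have : f y = k (Submodule.Quotient.mk y) := rfl
      simp [this, hy0]
    obtain ⟨c, hc⟩ := (Submodule.mem_span_range_iff_exists_fun ℝ).1 hspan
    have hc' : f = ∑ i, c i • i.1 := by
      ext x
      simpa using (LinearMap.congr_fun hc x).symm
    have hfx : f x₀ = G f := by
      rw [hc']
      rw [map_sum, sum_apply]
      exact Finset.sum_congr rfl fun i _ => by rw [map_smul, ← hx₀ i.1 i.2]; rfl
    calc ‖(Submodule.Quotient.mk x₀ : E ⧸ V)‖ = f x₀ := hkx.symm
      _ = G f := hfx
      _ ≤ ‖G f‖ := le_abs_self _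
      _ ≤ ‖G‖ * ‖f‖ := G.le_opNorm f
      _ ≤ ‖G‖ := mul_le_of_le_one_right (by positivity) hf
  obtain ⟨x, hx, hxn⟩ := Submodule.Quotient.norm_mk_lt
    (Submodule.Quotient.mk x₀ : E ⧸ V) zero_lt_one
  refine ⟨x, by linarith, fun f hf => ?_⟩
  have := hV (x - x₀) ((Submodule.Quotient.eq V).1 hx) f hf
  rw [map_sub, sub_eq_zero] at this
  rw [this, hx₀ f hf]

/-- A vector outside a closed subspace is separated from it by a functional vanishing on the
subspace. -/
theorem exists_dual_eq_one_of_notMem {E : Type*} [NormedAddCommGroup E] [NormedSpace ℝ E]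
    {V : Submodule ℝ E} (hV : IsClosed (V : Set E)) {x : E} (hx : x ∉ V) :
    ∃ f : StrongDual ℝ E, f x = 1 ∧ ∀ y ∈ V, f y = 0 := by
  have hn : ‖(Submodule.Quotient.mk x : E ⧸ V)‖ ≠ 0 := fun h0 => by
    have := hV
    exact hx ((Submodule.Quotient.mk_eq_zero V).1 (norm_eq_zero.1 h0))
  obtain ⟨k, -, hk⟩ := exists_dual_vector'' ℝ (Submodule.Quotient.mk x : E ⧸ V)
  refine ⟨(‖(Submodule.Quotient.mk x : E ⧸ V)‖)⁻¹ • k.comp V.mkQL, ?_, fun y hy => ?_⟩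
  · change (‖(Submodule.Quotient.mk x : E ⧸ V)‖)⁻¹ * k (Submodule.Quotient.mk x) = 1
    rw [hk]
    exact inv_mul_cancel₀ hn
  · change (‖(Submodule.Quotient.mk x : E ⧸ V)‖)⁻¹ * k (Submodule.Quotient.mk y) = 0
    rw [(Submodule.Quotient.mk_eq_zero V).2 hy, map_zero, mul_zero]

/-- **James's theorem**: a non-reflexive Banach space carries a bounded triangular system of
vectors and functionals. -/
theorem exists_triangular_system {X : Type*} [NormedAddCommGroup X]
    [NormedSpace ℝ X] [CompleteSpace X]
    (h : ¬ Function.Surjective ⇑(inclusionInDoubleDual ℝ X)) :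
    ∃ (K R : ℝ) (g : ℕ → X →L[ℝ] ℝ) (y : ℕ → X), (∀ m, ‖g m‖ ≤ K) ∧ (∀ n, ‖y n‖ ≤ R) ∧
      (∀ m n, m ≤ n → g m (y n) = 1) ∧ ∀ m n, n < m → g m (y n) = 0 := by
  classical
  obtain ⟨F, hF⟩ := not_forall.1 h
  have hJ : IsClosed (((inclusionInDoubleDual ℝ X).toLinearMap.range :
      Submodule ℝ (StrongDual ℝ (StrongDual ℝ X))) : Set (StrongDual ℝ (StrongDual ℝ X))) := by
    rw [LinearMap.coe_range]
    exact (inclusionInDoubleDualLi (E := X) ℝ).isometry.isUniformInducing.isComplete_range.isClosed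
  obtain ⟨G, hGF, hG'⟩ := exists_dual_eq_one_of_notMem hJ (x := F) hF
  have hG : ∀ x : X, G (inclusionInDoubleDual ℝ X x) = 0 := fun x =>
    hG' _ (LinearMap.mem_range_self _ x)
  have step : ∀ s : Finset (StrongDual ℝ X × X), (∀ q ∈ s, F q.1 = 1) →
      ∃ (g : StrongDual ℝ X) (y : X), ‖g‖ ≤ ‖G‖ + 1 ∧ ‖y‖ ≤ ‖F‖ + 1 ∧ F g = 1 ∧ g y = 1 ∧
        ∀ q ∈ s, g q.2 = 0 ∧ q.1 y = 1 := by
    intro s hs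
    obtain ⟨g, hgn, hg⟩ := exists_norm_le_forall_eq_bidual G
      (insert F (s.image fun q => inclusionInDoubleDual ℝ X q.2))
    have hgF : F g = 1 := by rw [hg F (Finset.mem_insert_self _ _), hGF]
    obtain ⟨y, hyn, hy⟩ := exists_norm_le_forall_eq_bidual F (insert g (s.image Prod.fst))
    refine ⟨g, y, hgn, hyn, hgF, ?_, fun q hq => ⟨?_, ?_⟩⟩
    · rw [hy g (Finset.mem_insert_self _ _), hgF]
    · have hmem : inclusionInDoubleDual ℝ X q.2 ∈
          s.image fun q => inclusionInDoubleDual ℝ X q.2 := Finset.mem_image.2 ⟨q, hq, rfl⟩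
      rw [← dual_def ℝ X q.2 g, hg _ (Finset.mem_insert_of_mem hmem), hG]
    · rw [hy q.1 (Finset.mem_insert_of_mem (Finset.mem_image.2 ⟨q, hq, rfl⟩)), hs q hq]
  generalize ‖G‖ + 1 = K at step
  generalize ‖F‖ + 1 = R at step
  obtain ⟨u, hu, hr⟩ := exists_seq_of_forall_finset_exists
    (fun q : StrongDual ℝ X × X => ‖q.1‖ ≤ K ∧ ‖q.2‖ ≤ R ∧ F q.1 = 1 ∧ q.1 q.2 = 1)
    (fun q q' => q'.1 q.2 = 0 ∧ q.1 q'.2 = 1) (fun s hs => by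
      obtain ⟨g, y, h₁, h₂, h₃, h₄, h₅⟩ := step s fun q hq => (hs q hq).2.2.1
      exact ⟨(g, y), ⟨h₁, h₂, h₃, h₄⟩, h₅⟩)
  refine ⟨K, R, fun m => (u m).1, fun n => (u n).2, fun m => (hu m).1, fun n => (hu n).2.1, ?_, ?_⟩
  · intro m n hmn
    rcases hmn.eq_or_lt with rfl | hlt
    · exact (hu m).2.2.2
    · exact (hr m n hlt).2
  · exact fun m n hnm => (hr n m hnm).1

/-- A bounded system in which the functionals `g m` are eventually null on every `z n`, while
`g m (z n) = 1` for `n ≥ m`, together with a splitting `ℝ e ⊕ ker φ` compatible with it. -/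
structure IsTriangularSystem_s9 {X : Type*} [NormedAddCommGroup X] [NormedSpace ℝ X]
    (φ : X →L[ℝ] ℝ) (e : X) (g : ℕ → X →L[ℝ] ℝ) (z : ℕ → X) (K R : ℝ) : Prop where
  R_pos : 0 < R
  norm_g_le : ∀ m, ‖g m‖ ≤ K
  norm_z_le : ∀ n, ‖z n‖ ≤ R
  φ_e : φ e = 1
  φ_z : ∀ n, φ (z n) = 0
  g_e : ∀ m, g m e = 0
  g_z_one : ∀ m n, m ≤ n → g m (z n) = 1
  g_z_zero : ∀ m n, n < m → g m (z n) = 0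

theorem exists_isTriangularSystem {X : Type*} [NormedAddCommGroup X]
    [NormedSpace ℝ X] [CompleteSpace X]
    (h : ¬ Function.Surjective ⇑(inclusionInDoubleDual ℝ X)) :
    ∃ (φ : X →L[ℝ] ℝ) (e : X) (g : ℕ → X →L[ℝ] ℝ) (z : ℕ → X) (K R : ℝ),
      IsTriangularSystem_s9 φ e g z K R := by
  obtain ⟨K, R, g, y, hg, hy, h1, h0⟩ := exists_triangular_system h
  have hR : 0 ≤ R := (norm_nonneg _).trans (hy 0)
  refine ⟨g 0, y 0, fun m => g (m + 1), fun n => y (n + 1) - y 0, K, R + R + 1,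
    by positivity, fun m => hg _, fun n => ?_, h1 0 0 le_rfl, fun n => ?_,
    fun m => h0 _ _ m.succ_pos, fun m n hmn => ?_, fun m n hnm => ?_⟩
  · linarith [norm_sub_le (y (n + 1)) (y 0), hy (n + 1), hy 0]
  · rw [map_sub, h1 0 _ (Nat.zero_le _), h1 0 0 le_rfl, sub_self]
  · rw [map_sub, h1 _ _ (by lia), h0 _ _ m.succ_pos, sub_zero]
  · rw [map_sub, h0 _ _ (by lia), h0 _ _ m.succ_pos, sub_zero]

/-- There is a seminorm killing the vectors of the system and dominating all the limits of its
functionals. -/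
theorem IsTriangularSystem_s9.exists_seminorm {X : Type*} [NormedAddCommGroup X] [NormedSpace ℝ X]
    {φ : X →L[ℝ] ℝ} {e : X} {g : ℕ → X →L[ℝ] ℝ} {z : ℕ → X} {K R : ℝ}
    (hS : IsTriangularSystem_s9 φ e g z K R) :
    ∃ p : Seminorm ℝ X, p e = 0 ∧ (∀ n, p (z n) = 0) ∧ (∀ x, p x ≤ K * ‖x‖) ∧
      ∀ x, ∀ ε > 0, ∀ᶠ m in atTop, |g m x| ≤ p x + ε := by
  have hK : 0 ≤ K := (norm_nonneg _).trans (hS.norm_g_le 0)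
  let V : Submodule ℝ X := Submodule.span ℝ (insert e (Set.range z))
  have hV : ∀ v ∈ V, ∀ᶠ m in atTop, g m v = 0 := by
    intro v hv
    induction hv using Submodule.span_induction with
    | mem v hv =>
      rcases hv with rfl | ⟨n, rfl⟩
      · exact Eventually.of_forall hS.g_e
      · exact (eventually_gt_atTop n).mono fun m hm => hS.g_z_zero m n hm
    | zero => simp
    | add v w _ _ hv hw =>
      filter_upwards [hv, hw] with m h1 h2
      rw [map_add, h1, h2, add_zero]
    | smul a v _ hv =>
      filter_upwards [hv] with m h1
      rw [map_smul, h1, smul_zero]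
  let p : Seminorm ℝ X := Seminorm.of (fun x => K * ‖(V.mkQ x : X ⧸ V)‖)
    (fun x y => by
      rw [map_add, ← mul_add]
      exact mul_le_mul_of_nonneg_left (norm_add_le _ _) hK)
    (fun a x => by rw [map_smul, norm_smul]; ring)
  have hp : ∀ x, p x = K * ‖(V.mkQ x : X ⧸ V)‖ := fun x => rfl
  have hp0 : ∀ v ∈ insert e (Set.range z), p v = 0 := fun v hv => by
    rw [hp, Submodule.mkQ_apply, (Submodule.Quotient.mk_eq_zero V).2 (Submodule.subset_span hv),
      norm_zero, mul_zero]
  refine ⟨p, hp0 _ (Or.inl rfl), fun n => hp0 _ (Or.inr ⟨n, rfl⟩), fun x => ?_, ?_⟩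
  · exact mul_le_mul_of_nonneg_left (Submodule.Quotient.norm_mk_le V x) hK
  · intro x ε hε
    obtain ⟨w, hw, hwn⟩ := Submodule.Quotient.norm_mk_lt
      (V.mkQ x : X ⧸ V) (ε := ε / (K + 1)) (by positivity)
    filter_upwards [hV (w - x) ((Submodule.Quotient.eq V).1 hw)] with m hm
    rw [map_sub, sub_eq_zero] at hm
    rw [← hm, hp]
    have h1 : |g m w| ≤ K * ‖w‖ := ((g m).le_opNorm w).trans
      (mul_le_mul_of_nonneg_right (hS.norm_g_le m) (norm_nonneg _))
    have h2 : K * ‖w‖ ≤ K * (‖(V.mkQ x : X ⧸ V)‖ + ε / (K + 1)) :=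
      mul_le_mul_of_nonneg_left hwn.le hK
    have h3 : K * (ε / (K + 1)) ≤ ε := by
      rw [mul_div_assoc', div_le_iff₀ (by positivity)]
      nlinarith
    linarith

/-- `N` is the largest of the seminorms `√((|φ x| + p x)² + (c ‖x - φ x • e‖)²)` and
`|(1 - 1 / (m + 2)) φ x + g m x|`. -/
structure IsTriangularNorm {X : Type*} [NormedAddCommGroup X] [NormedSpace ℝ X]
    (φ : X →L[ℝ] ℝ) (e : X) (p : Seminorm ℝ X) (g : ℕ → X →L[ℝ] ℝ) (c : ℝ) (N : X → ℝ) :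
    Prop where
  nonneg : ∀ x, 0 ≤ N x
  sq_le : ∀ x, (|φ x| + p x) ^ 2 + (c * ‖x - φ x • e‖) ^ 2 ≤ N x ^ 2
  abs_le : ∀ x (m : ℕ), |(1 - 1 / ((m : ℝ) + 2)) * φ x + g m x| ≤ N x
  le_of : ∀ x B, 0 ≤ B → (|φ x| + p x) ^ 2 + (c * ‖x - φ x • e‖) ^ 2 ≤ B ^ 2 →
    (∀ m : ℕ, |(1 - 1 / ((m : ℝ) + 2)) * φ x + g m x| ≤ B) → N x ≤ B

theorem one_div_add_two_mem (m : ℕ) : 0 < 1 / ((m : ℝ) + 2) ∧ 1 / ((m : ℝ) + 2) < 1 := by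
  refine ⟨by positivity, ?_⟩
  rw [div_lt_one (by positivity)]
  linarith [m.cast_nonneg (α := ℝ)]

theorem exists_isTriangularNorm {X : Type*} [NormedAddCommGroup X] [NormedSpace ℝ X]
    (φ : X →L[ℝ] ℝ) (e : X) (p : Seminorm ℝ X) (g : ℕ → X →L[ℝ] ℝ) (c K : ℝ)
    (hg : ∀ m, ‖g m‖ ≤ K) : ∃ N : X → ℝ, IsTriangularNorm φ e p g c N := by
  have hbdd : ∀ x, BddAbove (Set.range fun m : ℕ =>
      |(1 - 1 / ((m : ℝ) + 2)) * φ x + g m x|) := by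
    intro x
    refine ⟨|φ x| + K * ‖x‖, ?_⟩
    rintro _ ⟨m, rfl⟩
    obtain ⟨h0, h1⟩ := one_div_add_two_mem m
    have h2 : |g m x| ≤ K * ‖x‖ := ((g m).le_opNorm x).trans
      (mul_le_mul_of_nonneg_right (hg m) (norm_nonneg _))
    have h3 : |(1 - 1 / ((m : ℝ) + 2)) * φ x| ≤ |φ x| := by
      rw [abs_mul, abs_of_nonneg (by linarith)]
      exact mul_le_of_le_one_left (abs_nonneg _) (by linarith)
    exact (abs_add_le _ _).trans (add_le_add h3 h2)
  refine ⟨fun x => max √((|φ x| + p x) ^ 2 + (c * ‖x - φ x • e‖) ^ 2)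
    (⨆ m : ℕ, |(1 - 1 / ((m : ℝ) + 2)) * φ x + g m x|), fun x => ?_, fun x => ?_,
    fun x m => ?_, fun x B hB h1 h2 => ?_⟩
  · exact le_max_of_le_left (Real.sqrt_nonneg _)
  · exact (Real.sqrt_le_left (le_max_of_le_left (Real.sqrt_nonneg _))).1 (le_max_left _ _)
  · exact (le_ciSup (hbdd x) m).trans (le_max_right _ _)
  · exact max_le ((Real.sqrt_le_left hB).2 h1) (ciSup_le h2)

/-- The triangle inequality in the Euclidean plane. -/
theorem sq_add_sq_le_of_le_add {a b a₁ b₁ a₂ b₂ r s : ℝ} (ha0 : 0 ≤ a) (hb0 : 0 ≤ b)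
    (ha : a ≤ a₁ + a₂) (hb : b ≤ b₁ + b₂) (hr : 0 ≤ r) (hs : 0 ≤ s)
    (h₁ : a₁ ^ 2 + b₁ ^ 2 ≤ r ^ 2) (h₂ : a₂ ^ 2 + b₂ ^ 2 ≤ s ^ 2) :
    a ^ 2 + b ^ 2 ≤ (r + s) ^ 2 := by
  have hcs : a₁ * a₂ + b₁ * b₂ ≤ r * s := by
    refine le_of_sq_le_sq ?_ (mul_nonneg hr hs)
    have : (a₁ ^ 2 + b₁ ^ 2) * (a₂ ^ 2 + b₂ ^ 2) ≤ r ^ 2 * s ^ 2 := by gcongr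
    nlinarith [sq_nonneg (a₁ * b₂ - a₂ * b₁)]
  have ha2 : a ^ 2 ≤ (a₁ + a₂) ^ 2 := by gcongr
  have hb2 : b ^ 2 ≤ (b₁ + b₂) ^ 2 := by gcongr
  nlinarith

theorem IsTriangularNorm.isEquivNorm {X : Type*} [NormedAddCommGroup X] [NormedSpace ℝ X]
    {φ : X →L[ℝ] ℝ} {e : X} {p : Seminorm ℝ X} {g : ℕ → X →L[ℝ] ℝ} {c : ℝ} {N : X → ℝ}
    (hN : IsTriangularNorm φ e p g c N) (hc : 0 < c) {K : ℝ} (hg : ∀ m, ‖g m‖ ≤ K)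
    (hp : ∀ x, p x ≤ K * ‖x‖) : IsEquivNorm N := by
  have hK : 0 ≤ K := (norm_nonneg _).trans (hg 0)
  have hsmul : ∀ (a : ℝ) (x : X), N (a • x) ≤ |a| * N x := by
    intro a x
    refine hN.le_of _ _ (mul_nonneg (abs_nonneg a) (hN.nonneg x)) ?_ fun m => ?_
    · have h1 : a • x - φ (a • x) • e = a • (x - φ x • e) := by
        rw [map_smul, smul_sub, smul_assoc]
      have h2 : p (a • x) = |a| * p x := map_smul_eq_mul p a x
      rw [h1, h2, norm_smul, map_smul, smul_eq_mul, abs_mul, Real.norm_eq_abs]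
      have := mul_le_mul_of_nonneg_left (hN.sq_le x) (sq_nonneg |a|)
      nlinarith
    · have : (1 - 1 / ((m : ℝ) + 2)) * φ (a • x) + g m (a • x) =
          a * ((1 - 1 / ((m : ℝ) + 2)) * φ x + g m x) := by
        rw [map_smul, map_smul, smul_eq_mul, smul_eq_mul]; ring
      rw [this, abs_mul]
      exact mul_le_mul_of_nonneg_left (hN.abs_le x m) (abs_nonneg a)
  refine ⟨fun x y => ?_, fun a x => (hsmul a x).antisymm ?_, ?_, ?_⟩
  · refine hN.le_of _ _ (add_nonneg (hN.nonneg x) (hN.nonneg y)) ?_ fun m => ?_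
    · refine sq_add_sq_le_of_le_add (by positivity) (by positivity) ?_ ?_ (hN.nonneg x)
        (hN.nonneg y) (hN.sq_le x) (hN.sq_le y)
      · rw [map_add]
        linarith [abs_add_le (φ x) (φ y), map_add_le_add p x y]
      · rw [map_add, add_smul, add_sub_add_comm, ← mul_add]
        exact mul_le_mul_of_nonneg_left (norm_add_le _ _) hc.le
    · have : (1 - 1 / ((m : ℝ) + 2)) * φ (x + y) + g m (x + y) =
          ((1 - 1 / ((m : ℝ) + 2)) * φ x + g m x) +
          ((1 - 1 / ((m : ℝ) + 2)) * φ y + g m y) := by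
        rw [map_add, map_add]; ring
      rw [this]
      exact (abs_add_le _ _).trans (add_le_add (hN.abs_le x m) (hN.abs_le y m))
  · rcases eq_or_ne a 0 with rfl | ha
    · simpa using hN.nonneg _
    · have h1 := hsmul a⁻¹ (a • x)
      rw [inv_smul_smul₀ ha, abs_inv, ← div_eq_inv_mul, le_div_iff₀ (abs_pos.2 ha)] at h1
      linarith
  · refine ⟨(1 / c + ‖e‖)⁻¹, by positivity, fun x => ?_⟩
    rw [inv_mul_le_iff₀ (by positivity)]
    have hsq := hN.sq_le x
    have h1 : |φ x| ≤ N x := by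
      have : |φ x| + p x ≤ N x :=
        le_of_sq_le_sq (by nlinarith [sq_nonneg (c * ‖x - φ x • e‖)]) (hN.nonneg x)
      linarith [apply_nonneg p x]
    have h2 : c * ‖x - φ x • e‖ ≤ N x :=
      le_of_sq_le_sq (by nlinarith [sq_nonneg (|φ x| + p x)]) (hN.nonneg x)
    have h3 : ‖x - φ x • e‖ ≤ 1 / c * N x := by
      rw [one_div, ← div_eq_inv_mul, le_div_iff₀ hc]
      linarith
    calc ‖x‖ = ‖(x - φ x • e) + φ x • e‖ := by rw [sub_add_cancel]
      _ ≤ ‖x - φ x • e‖ + |φ x| * ‖e‖ := (norm_add_le _ _).trans_eq (by rw [norm_smul]; rfl)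
      _ ≤ 1 / c * N x + N x * ‖e‖ := by gcongr
      _ = (1 / c + ‖e‖) * N x := by ring
  · refine ⟨‖φ‖ + K + c * (1 + ‖φ‖ * ‖e‖) + 1, by positivity, fun x => ?_⟩
    have hφ : |φ x| ≤ ‖φ‖ * ‖x‖ := φ.le_opNorm x
    have h2 : c * ‖x - φ x • e‖ ≤ c * (1 + ‖φ‖ * ‖e‖) * ‖x‖ := by
      rw [mul_assoc]
      refine mul_le_mul_of_nonneg_left ?_ hc.le
      calc ‖x - φ x • e‖ ≤ ‖x‖ + |φ x| * ‖e‖ := (norm_sub_le _ _).trans_eq (by rw [norm_smul]; rfl)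
        _ ≤ ‖x‖ + ‖φ‖ * ‖x‖ * ‖e‖ := by gcongr
        _ = (1 + ‖φ‖ * ‖e‖) * ‖x‖ := by ring
    have hB : (|φ x| + p x) + c * ‖x - φ x • e‖ ≤
        (‖φ‖ + K + c * (1 + ‖φ‖ * ‖e‖) + 1) * ‖x‖ := by
      linarith [hp x, norm_nonneg x]
    have hp0 := apply_nonneg p x
    have hb0 : 0 ≤ c * ‖x - φ x • e‖ := by positivity
    have ha0 : 0 ≤ |φ x| + p x := by positivity
    refine hN.le_of _ _ (by positivity) ?_ fun m => ?_
    · refine le_trans ?_ (pow_le_pow_left₀ (add_nonneg ha0 hb0) hB 2)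
      nlinarith
    · obtain ⟨h0, h1⟩ := one_div_add_two_mem m
      have h4 : |g m x| ≤ K * ‖x‖ := ((g m).le_opNorm x).trans
        (mul_le_mul_of_nonneg_right (hg m) (norm_nonneg _))
      have h3 : |(1 - 1 / ((m : ℝ) + 2)) * φ x| ≤ |φ x| := by
        rw [abs_mul, abs_of_nonneg (by linarith)]
        exact mul_le_of_le_one_left (abs_nonneg _) (by linarith)
      have h5 := abs_add_le ((1 - 1 / ((m : ℝ) + 2)) * φ x) (g m x)
      have h6 : 0 ≤ c * (1 + ‖φ‖ * ‖e‖) * ‖x‖ := by positivity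
      linarith [norm_nonneg x]

/-- The support functionals of a triangular norm at `e` are dominated by `p` on the kernel
of `φ`. -/
theorem IsTriangularNorm.apply_le {X : Type*} [NormedAddCommGroup X] [NormedSpace ℝ X]
    {φ : X →L[ℝ] ℝ} {e : X} {p : Seminorm ℝ X} {g : ℕ → X →L[ℝ] ℝ} {z : ℕ → X} {c K R : ℝ}
    {N : X → ℝ} (hN : IsTriangularNorm φ e p g c N) (hS : IsTriangularSystem_s9 φ e g z K R)
    (hpe : p e = 0) (hlim : ∀ x, ∀ ε > 0, ∀ᶠ m in atTop, |g m x| ≤ p x + ε)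
    {f : X →L[ℝ] ℝ} (hf : ∀ x, |f x| ≤ N x) (hfe : f e = 1) {y : X} (hy : φ y = 0) :
    f y ≤ p y := by
  refine le_of_forall_pos_le_add fun ε hε => ?_
  obtain ⟨M, hM⟩ := eventually_atTop.1 (hlim y ε hε)
  have hK : 0 ≤ K := (norm_nonneg _).trans (hS.norm_g_le 0)
  have hp0 := apply_nonneg p y
  obtain ⟨hδ, -⟩ := one_div_add_two_mem M
  obtain ⟨t, ht, ht1, ht2⟩ : ∃ t : ℝ, 0 < t ∧ t * (c ^ 2 * ‖y‖ ^ 2) ≤ 2 * ε ∧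
      t * (K * ‖y‖) ≤ 1 / ((M : ℝ) + 2) := by
    have hD : 0 < c ^ 2 * ‖y‖ ^ 2 + K * ‖y‖ + 1 := by positivity
    have hD1 : 0 ≤ c ^ 2 * ‖y‖ ^ 2 := by positivity
    have hD2 : 0 ≤ K * ‖y‖ := by positivity
    have hmin : 0 < min (2 * ε) (1 / ((M : ℝ) + 2)) := lt_min (by positivity) hδ
    refine ⟨min (2 * ε) (1 / ((M : ℝ) + 2)) / (c ^ 2 * ‖y‖ ^ 2 + K * ‖y‖ + 1),
      div_pos hmin hD, ?_, ?_⟩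
    · rw [div_mul_eq_mul_div, div_le_iff₀ hD]
      exact mul_le_mul (min_le_left _ _) (by linarith) hD1 (by positivity)
    · rw [div_mul_eq_mul_div, div_le_iff₀ hD]
      exact mul_le_mul (min_le_right _ _) (by linarith) hD2 hδ.le
  have hφ : φ (e + t • y) = 1 := by rw [map_add, map_smul, hy, hS.φ_e]; simp
  have key : N (e + t • y) ≤ 1 + t * (p y + ε) := by
    refine hN.le_of _ _ (by positivity) ?_ fun m => ?_
    · have hpt : p (e + t • y) ≤ t * p y := by
        have h1 := map_add_le_add p e (t • y)
        rw [hpe, map_smul_eq_mul, Real.norm_eq_abs, abs_of_pos ht, zero_add] at h1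
        exact h1
      have h1 : (|φ (e + t • y)| + p (e + t • y)) ^ 2 ≤ (1 + t * p y) ^ 2 := by
        rw [hφ, abs_one]
        gcongr
      have h2 : (c * ‖e + t • y - φ (e + t • y) • e‖) ^ 2 = t * (t * (c ^ 2 * ‖y‖ ^ 2)) := by
        rw [hφ, one_smul, add_sub_cancel_left, norm_smul, Real.norm_eq_abs, abs_of_pos ht]
        ring
      have h3 : t * (t * (c ^ 2 * ‖y‖ ^ 2)) ≤ t * (2 * ε) := mul_le_mul_of_nonneg_left ht1 ht.le
      have h4 : 0 ≤ t * ε * (t * p y) := by positivity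
      rw [h2]
      nlinarith [sq_nonneg (t * ε)]
    · obtain ⟨h0, h1⟩ := one_div_add_two_mem m
      have h2 : (1 - 1 / ((m : ℝ) + 2)) * φ (e + t • y) + g m (e + t • y) =
          (1 - 1 / ((m : ℝ) + 2)) + t * g m y := by
        rw [hφ, map_add, map_smul, hS.g_e, smul_eq_mul]; ring
      have h3 : |(1 - 1 / ((m : ℝ) + 2)) + t * g m y| ≤
          (1 - 1 / ((m : ℝ) + 2)) + t * |g m y| := by
        refine (abs_add_le _ _).trans_eq ?_
        rw [abs_of_nonneg (by linarith), abs_mul, abs_of_pos ht]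
      rw [h2]
      refine h3.trans ?_
      rcases le_total M m with hm | hm
      · have := mul_le_mul_of_nonneg_left (hM m hm) ht.le
        linarith
      · have h4 : |g m y| ≤ K * ‖y‖ := ((g m).le_opNorm y).trans
          (mul_le_mul_of_nonneg_right (hS.norm_g_le m) (norm_nonneg _))
        have h5 := mul_le_mul_of_nonneg_left h4 ht.le
        have h6 : 1 / ((M : ℝ) + 2) ≤ 1 / ((m : ℝ) + 2) := by gcongr
        have h7 : 0 ≤ t * (p y + ε) := by positivity
        linarith
  have h1 := (le_abs_self _).trans ((hf (e + t • y)).trans key)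
  rw [map_add, map_smul, hfe, smul_eq_mul] at h1
  exact le_of_mul_le_mul_left (by linarith) ht

theorem IsTriangularNorm.nsePoint {X : Type*} [NormedAddCommGroup X] [NormedSpace ℝ X]
    {φ : X →L[ℝ] ℝ} {e : X} {p : Seminorm ℝ X} {g : ℕ → X →L[ℝ] ℝ} {z : ℕ → X} {c K R : ℝ}
    {N : X → ℝ} (hN : IsTriangularNorm φ e p g c N) (hS : IsTriangularSystem_s9 φ e g z K R)
    (hc : 0 < c) (hpe : p e = 0)
    (hlim : ∀ x, ∀ ε > 0, ∀ᶠ m in atTop, |g m x| ≤ p x + ε) : NSEPoint N e := by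
  intro f hf hfe xs hxs hfx
  have hle : ∀ x, f x ≤ |φ x| + p x := by
    intro x
    have h1 := hN.apply_le hS hpe hlim hf.1 hfe (y := x - φ x • e)
      (by rw [map_sub, map_smul, hS.φ_e]; simp)
    have h2 : p (x - φ x • e) ≤ p x := by
      have := map_sub_le_add p x (φ x • e)
      rwa [map_smul_eq_mul, hpe, mul_zero, add_zero] at this
    rw [map_sub, map_smul, hfe, smul_eq_mul, mul_one] at h1
    linarith [le_abs_self (φ x)]
  have hsq : ∀ᶠ n in atTop, ‖xs n - φ (xs n) • e‖ ^ 2 ≤ (1 - f (xs n) ^ 2) / c ^ 2 := by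
    filter_upwards [hfx.eventually (lt_mem_nhds zero_lt_one)] with n hn
    rw [le_div_iff₀ (by positivity)]
    have h1 : f (xs n) ^ 2 ≤ (|φ (xs n)| + p (xs n)) ^ 2 := by
      have := hle (xs n)
      gcongr
    have h2 : N (xs n) ^ 2 ≤ 1 := pow_le_one₀ (hN.nonneg _) (hxs n)
    nlinarith [hN.sq_le (xs n)]
  have h0 : Tendsto (fun n => ‖xs n - φ (xs n) • e‖ ^ 2) atTop (𝓝 0) := by
    refine tendsto_of_tendsto_of_tendsto_of_le_of_le' tendsto_const_nhds ?_
      (Eventually.of_forall fun n => by positivity) hsq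
    simpa using ((tendsto_const_nhds (x := (1 : ℝ))).sub (hfx.pow 2)).div_const (c ^ 2)
  have h1 : Tendsto (fun n => xs n - φ (xs n) • e) atTop (𝓝 0) := by
    rw [tendsto_zero_iff_norm_tendsto_zero]
    simpa using h0.sqrt
  have h2 : Tendsto (fun n => φ (xs n)) atTop (𝓝 1) := by
    have h3 := hfx.sub ((f.continuous.tendsto 0).comp h1)
    simpa [hfe] using h3
  have h4 := h1.add (h2.smul_const e)
  simpa using h4

/-- Normalizing a functional with respect to a norm `N`. -/
theorem exists_dualSphere_inv_smul {X : Type*} [NormedAddCommGroup X] [NormedSpace ℝ X]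
    {N : X → ℝ} {f : X →L[ℝ] ℝ} (hN : ∀ x, 0 ≤ N x) (hf : ∀ x, |f x| ≤ N x) {b : ℝ}
    (hb : 0 < b) {u : X} (hu : N u ≤ 1) (hfu : b ≤ f u) :
    ∃ ν, b ≤ ν ∧ ν ≤ 1 ∧ DualSphere N (ν⁻¹ • f) := by
  let S : Set ℝ := {r | ∀ x, |f x| ≤ r * N x}
  have hS1 : (1 : ℝ) ∈ S := fun x => by simpa using hf x
  have hSb : ∀ r ∈ S, b ≤ r := fun r hr => by
    have h1 : b ≤ r * N u := hfu.trans ((le_abs_self _).trans (hr u))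
    have h2 : 0 < r := by
      by_contra! h
      nlinarith [hN u]
    nlinarith [hN u]
  have hbdd : BddBelow S := ⟨b, hSb⟩
  have hν : b ≤ sInf S := le_csInf ⟨1, hS1⟩ hSb
  have hν0 : 0 < sInf S := hb.trans_le hν
  have hclosed : IsClosed S := by
    have : S = ⋂ x, {r | |f x| ≤ r * N x} := by ext; simp [S]
    rw [this]
    exact isClosed_iInter fun x => isClosed_le continuous_const (by fun_prop)
  have hmem : sInf S ∈ S := hclosed.csInf_mem ⟨1, hS1⟩ hbdd
  have hval : ∀ x, |((sInf S)⁻¹ • f) x| = (sInf S)⁻¹ * |f x| := fun x => by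
    change |(sInf S)⁻¹ * f x| = _
    rw [abs_mul, abs_of_pos (inv_pos.2 hν0)]
  refine ⟨sInf S, hν, csInf_le hbdd hS1, fun x => ?_, fun r hr => ?_⟩
  · rw [hval, inv_mul_le_iff₀ hν0]
    exact hmem x
  · have h1 : sInf S * r ∈ S := fun x => by
      have := hr x
      rw [hval, inv_mul_le_iff₀ hν0] at this
      linarith
    have h2 := csInf_le hbdd h1
    exact le_of_mul_le_mul_left (by linarith) hν0

theorem IsTriangularNorm.apply_eq_one {X : Type*} [NormedAddCommGroup X] [NormedSpace ℝ X]
    {φ : X →L[ℝ] ℝ} {e : X} {p : Seminorm ℝ X} {g : ℕ → X →L[ℝ] ℝ} {z : ℕ → X} {c K R : ℝ}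
    {N : X → ℝ} (hN : IsTriangularNorm φ e p g c N) (hS : IsTriangularSystem_s9 φ e g z K R)
    (hpe : p e = 0) : N e = 1 := by
  refine le_antisymm (hN.le_of _ _ zero_le_one ?_ fun m => ?_) ?_
  · simp [hS.φ_e, hpe]
  · obtain ⟨h0, h1⟩ := one_div_add_two_mem m
    rw [hS.φ_e, hS.g_e, mul_one, add_zero, abs_of_nonneg (by linarith)]
    linarith
  · have := hN.sq_le e
    rw [hS.φ_e, hpe, one_smul, sub_self, norm_zero, abs_one] at this
    exact le_of_sq_le_sq (by linarith) (hN.nonneg e)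

theorem IsTriangularNorm.not_walurPoint {X : Type*} [NormedAddCommGroup X] [NormedSpace ℝ X]
    {φ : X →L[ℝ] ℝ} {e : X} {p : Seminorm ℝ X} {g : ℕ → X →L[ℝ] ℝ} {z : ℕ → X} {K R : ℝ}
    {N : X → ℝ} (hN : IsTriangularNorm φ e p g (1 / R) N)
    (hS : IsTriangularSystem_s9 φ e g z K R) (hpe : p e = 0) (hpz : ∀ n, p (z n) = 0)
    (hNsmul : ∀ (a : ℝ) (x : X), N (a • x) = |a| * N x) : ¬ WALURPoint N e := by
  intro hW
  let F : ℕ → X →L[ℝ] ℝ := fun m => (1 - 1 / ((m : ℝ) + 2)) • φ + g m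
  have hF : ∀ m x, F m x = (1 - 1 / ((m : ℝ) + 2)) * φ x + g m x := fun m x => rfl
  have hFN : ∀ m x, |F m x| ≤ N x := fun m x => hN.abs_le x m
  let u : ℕ → X := fun n => (2 : ℝ)⁻¹ • (z n + e)
  have hφu : ∀ n, φ (u n) = 2⁻¹ := fun n => by
    simp [u, hS.φ_e, hS.φ_z]
  have hFu1 : ∀ m n, m ≤ n → F m (u n) = 1 - 1 / ((m : ℝ) + 2) / 2 := fun m n hmn => by
    rw [hF, hφu]
    simp only [u, map_smul, map_add, hS.g_e, hS.g_z_one m n hmn, smul_eq_mul]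
    ring
  have hFu0 : ∀ m n, n < m → F m (u n) = (1 - 1 / ((m : ℝ) + 2)) / 2 := fun m n hmn => by
    rw [hF, hφu]
    simp only [u, map_smul, map_add, hS.g_e, hS.g_z_zero m n hmn, smul_eq_mul]
    ring
  have hNu : ∀ n, N (u n) ≤ 1 := fun n => by
    refine hN.le_of _ _ zero_le_one ?_ fun m => ?_
    · have h1 : p (u n) = 0 := by
        have h2 : p (z n + e) ≤ 0 := (map_add_le_add p _ _).trans_eq (by rw [hpz, hpe, add_zero])
        simp only [u]
        rw [map_smul_eq_mul, h2.antisymm (apply_nonneg p _), mul_zero]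
      have h2 : u n - φ (u n) • e = (2 : ℝ)⁻¹ • z n := by
        rw [hφu]
        simp only [u]
        rw [smul_add, add_sub_cancel_right]
      have h3 : 1 / R * ‖(2 : ℝ)⁻¹ • z n‖ ≤ 2⁻¹ := by
        rw [norm_smul, one_div, inv_mul_le_iff₀ hS.R_pos]
        norm_num
        linarith [hS.norm_z_le n]
      have h4 : 0 ≤ 1 / R * ‖(2 : ℝ)⁻¹ • z n‖ := by
        have := hS.R_pos
        positivity
      rw [h1, h2, hφu, abs_of_pos (by norm_num)]
      nlinarith
    · obtain ⟨h0, h1⟩ := one_div_add_two_mem m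
      rw [← hF]
      rcases le_or_gt m n with hmn | hmn
      · rw [hFu1 m n hmn, abs_of_nonneg (by linarith)]
        linarith
      · rw [hFu0 m n hmn, abs_of_nonneg (by linarith)]
        linarith
  have hδ : Tendsto (fun m : ℕ => 1 / ((m : ℝ) + 2)) atTop (𝓝 0) := by
    simpa [Function.comp_def, add_assoc, one_add_one_eq_two] using
      (tendsto_one_div_add_atTop_nhds_zero_nat (𝕜 := ℝ)).comp (tendsto_add_atTop_nat 1)
  have hδ2 : Tendsto (fun m : ℕ => 1 - 1 / ((m : ℝ) + 2) / 2) atTop (𝓝 1) := by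
    simpa using tendsto_const_nhds.sub (hδ.div_const 2)
  have hNu' : ∀ n : ℕ, 1 - 1 / ((n : ℝ) + 2) / 2 ≤ N (u n) := fun n => by
    rw [← hFu1 n n le_rfl]
    exact (le_abs_self _).trans (hFN n _)
  have hNu0 : ∀ n, 0 < N (u n) := fun n => by
    linarith [hNu' n, (one_div_add_two_mem n).2]
  have hNlim : Tendsto (fun n => (N (u n))⁻¹) atTop (𝓝 1) := by
    simpa using (tendsto_of_tendsto_of_tendsto_of_le_of_le hδ2 tendsto_const_nhds hNu'
      hNu).inv₀ one_ne_zero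
  have hν : ∀ m : ℕ, ∃ ν, 1 - 1 / ((m : ℝ) + 2) / 2 ≤ ν ∧ ν ≤ 1 ∧ DualSphere N (ν⁻¹ • F m) :=
    fun m => exists_dualSphere_inv_smul hN.nonneg (hFN m)
      (by linarith [(one_div_add_two_mem m).2]) (hNu m) (hFu1 m m le_rfl).ge
  choose ν hν1 hν2 hνF using hν
  have hνlim : Tendsto (fun m => (ν m)⁻¹) atTop (𝓝 1) := by
    simpa using (tendsto_of_tendsto_of_tendsto_of_le_of_le hδ2 tendsto_const_nhds hν1
      hν2).inv₀ one_ne_zero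
  have hconv := hW (fun n => (N (u n))⁻¹ • u n) (fun m => (ν m)⁻¹ • F m)
    (fun m => (ν m)⁻¹ * (2⁻¹ * (1 * (1 - 1 / ((m : ℝ) + 2) / 2) + (1 - 1 / ((m : ℝ) + 2)))))
    (fun n => by
      rw [hNsmul, abs_of_pos (inv_pos.2 (hNu0 n)), inv_mul_cancel₀ (hNu0 n).ne'])
    hνF
    (fun m => by
      refine Tendsto.congr' (f₁ := fun n => (ν m)⁻¹ * (2⁻¹ * ((N (u n))⁻¹ *
        (1 - 1 / ((m : ℝ) + 2) / 2) + (1 - 1 / ((m : ℝ) + 2))))) ?_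
        (((hNlim.mul_const _).add_const _).const_mul _ |>.const_mul _)
      filter_upwards [eventually_ge_atTop m] with n hn
      have hFe : F m e = 1 - 1 / ((m : ℝ) + 2) := by
        rw [hF, hS.φ_e, hS.g_e, mul_one, add_zero]
      change _ = (ν m)⁻¹ * F m ((2 : ℝ)⁻¹ • ((N (u n))⁻¹ • u n + e))
      rw [map_smul, map_add, map_smul, hFu1 m n hn, hFe, smul_eq_mul, smul_eq_mul])
    (by
      have h1 := hνlim.mul (((hδ2.const_mul 1).add
        ((tendsto_const_nhds (x := (1 : ℝ))).sub hδ)).const_mul (2 : ℝ)⁻¹)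
      have h2 : (1 : ℝ) * (2⁻¹ * (1 * 1 + (1 - 0))) = 1 := by norm_num
      rwa [h2] at h1)
    φ
  have hhalf : Tendsto (fun n => φ ((N (u n))⁻¹ • u n)) atTop (𝓝 (1 * 2⁻¹)) := by
    simp only [map_smul, hφu, smul_eq_mul]
    exact hNlim.mul_const _
  have := tendsto_nhds_unique hconv hhalf
  rw [hS.φ_e] at this
  norm_num at this

/-- Every non-reflexive Banach space admits an equivalent norm whose unit sphere contains
an NSE point which is not a w-aLUR point. -/
theorem nonreflexive_renorming_NSE_not_wALUR {X : Type*} [NormedAddCommGroup X]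
    [NormedSpace ℝ X] [CompleteSpace X]
    (h : ¬ Function.Surjective ⇑(inclusionInDoubleDual ℝ X)) :
    ∃ N : X → ℝ, IsEquivNorm N ∧
      ∃ x : X, N x = 1 ∧ NSEPoint N x ∧ ¬ WALURPoint N x := by
  obtain ⟨φ, e, g, z, K, R, hS⟩ := exists_isTriangularSystem h
  obtain ⟨p, hpe, hpz, hpK, hlim⟩ := hS.exists_seminorm
  obtain ⟨N, hN⟩ := exists_isTriangularNorm φ e p g (1 / R) K hS.norm_g_le
  have hc : 0 < 1 / R := one_div_pos.2 hS.R_pos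
  have hequiv := hN.isEquivNorm hc hS.norm_g_le hpK
  exact ⟨N, hequiv, e, hN.apply_eq_one hS hpe, hN.nsePoint hS hc hpe hlim,
    hN.not_walurPoint hS hpe hpz hequiv.smul_eq⟩
end

section
/- Let X be a non-reflexive real Banach space. Then X admits a norm |||·||| equivalent to its original norm such that there exists a point x ∈ S_{(X,|||·|||)} which is a nicely strongly exposed (NSE) point of S_{(X,|||·|||)} but is not an almost locally uniformly rotund (aLUR) point of S_{(X,|||·|||)}. -/
open Filter Topology NormedSpace

/-- Helly's theorem on the solvability of finitely many linear equations with a norm bound. -/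
theorem exists_norm_le_forall_apply_eq {E ι : Type*} [SeminormedAddCommGroup E] [NormedSpace ℝ E]
    [Fintype ι] (φ : ι → E →L[ℝ] ℝ) (α : ι → ℝ) {M ε : ℝ} (hM0 : 0 ≤ M) (hε : 0 < ε)
    (hM : ∀ c : ι → ℝ, |∑ i, c i * α i| ≤ M * ‖∑ i, c i • φ i‖) :
    ∃ x : E, ‖x‖ ≤ M + ε ∧ ∀ i, φ i x = α i := by
  classical
  set T : E →ₗ[ℝ] ι → ℝ := LinearMap.pi fun i => (φ i : E →ₗ[ℝ] ℝ) with hT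
  obtain ⟨x₀, hx₀⟩ : α ∈ LinearMap.range T := by
    by_contra hα
    obtain ⟨l, hl, hle⟩ := Submodule.exists_le_ker_of_notMem hα
    have hsum : ∀ v : ι → ℝ, l v = ∑ i, l (Pi.single i 1) * v i := fun v => by
      rw [LinearMap.pi_apply_eq_sum_univ l v]
      exact Finset.sum_congr rfl fun i _ => by
        rw [smul_eq_mul, mul_comm]; congr 2; ext j; simp [Pi.single_apply, eq_comm]
    have h0 : ∑ i, l (Pi.single i 1) • φ i = 0 := by
      ext x
      have : l (T x) = 0 := hle ⟨x, rfl⟩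
      rw [hsum] at this
      simpa [hT] using this
    have := hM fun i => l (Pi.single i 1)
    rw [h0, ← hsum, norm_zero, mul_zero] at this
    exact hl (abs_nonpos_iff.1 this)
  obtain ⟨g, hg1, hg⟩ := exists_dual_vector'' ℝ (Submodule.Quotient.mk x₀ : E ⧸ LinearMap.ker T)
  set ψ : E →ₗ[ℝ] ℝ := (g : (E ⧸ LinearMap.ker T) →ₗ[ℝ] ℝ) ∘ₗ (LinearMap.ker T).mkQ with hψ
  have hker : ⨅ i, LinearMap.ker (φ i : E →ₗ[ℝ] ℝ) ≤ LinearMap.ker ψ := by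
    intro x hx
    have hx' : x ∈ LinearMap.ker T := by
      simp only [Submodule.mem_iInf, LinearMap.mem_ker] at hx
      ext i
      exact hx i
    simp [hψ, (Submodule.Quotient.mk_eq_zero _).2 hx']
  obtain ⟨c, hc⟩ := (Submodule.mem_span_range_iff_exists_fun ℝ).1 (mem_span_of_iInf_ker_le_ker hker)
  have hval : ∀ x, (∑ i, c i • φ i) x = ψ x := fun x => by
    rw [← hc]; simp
  have hnorm : ‖∑ i, c i • φ i‖ ≤ 1 := by
    refine ContinuousLinearMap.opNorm_le_bound _ zero_le_one fun x => ?_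
    rw [hval, one_mul]
    exact (g.le_of_opNorm_le hg1 _).trans
      (by rw [one_mul]; exact Submodule.Quotient.norm_mk_le _ x)
  have hx₀' : ‖(Submodule.Quotient.mk x₀ : E ⧸ LinearMap.ker T)‖ = ∑ i, c i * α i := by
    have h1 : ψ x₀ = ‖(Submodule.Quotient.mk x₀ : E ⧸ LinearMap.ker T)‖ := hg
    rw [← h1, ← hval, ← hx₀]
    simp [hT]
  obtain ⟨x, hx, hxlt⟩ := Submodule.Quotient.norm_mk_lt
    (Submodule.Quotient.mk x₀ : E ⧸ LinearMap.ker T) hε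
  refine ⟨x, ?_, fun i => ?_⟩
  · have h1 := (le_abs_self _).trans (hM c)
    have h2 := mul_le_of_le_one_right hM0 hnorm
    linarith
  · have h1 : T (x - x₀) = 0 := (Submodule.Quotient.eq _).1 hx
    rw [map_sub, sub_eq_zero, hx₀] at h1
    exact congrFun h1 i

theorem exists_norm_le_forall_mem_apply_eq {X : Type*} [NormedAddCommGroup X] [NormedSpace ℝ X]
    (F : StrongDual ℝ (StrongDual ℝ X)) (S : Finset (StrongDual ℝ X)) :
    ∃ x : X, ‖x‖ ≤ ‖F‖ + 1 ∧ ∀ f ∈ S, f x = F f := by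
  obtain ⟨x, hx, hS⟩ := exists_norm_le_forall_apply_eq (fun f : S => (f : StrongDual ℝ X))
    (fun f => F f) (norm_nonneg F) one_pos fun c => by
      have := F.le_opNorm (∑ i : S, c i • (i : StrongDual ℝ X))
      simpa using this
  exact ⟨x, hx, fun f hf => hS ⟨f, hf⟩⟩

/-- A bidual element at distance at least `d` from `X` can be normalised on a bounded functional
vanishing on a prescribed finite set. -/
theorem exists_annihilating_functional {X : Type*} [NormedAddCommGroup X] [NormedSpace ℝ X]
    {F : StrongDual ℝ (StrongDual ℝ X)} {d : ℝ} (hd : 0 < d)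
    (hF : ∀ x, d ≤ ‖F - inclusionInDoubleDual ℝ X x‖) (S : Finset X) :
    ∃ f : StrongDual ℝ X, ‖f‖ ≤ d⁻¹ + 1 ∧ F f = 1 ∧ ∀ x ∈ S, f x = 0 := by
  obtain ⟨f, hf, hS⟩ := exists_norm_le_forall_apply_eq
    (fun i : Option S => i.elim F fun x => inclusionInDoubleDual ℝ X x)
    (fun i => i.elim 1 fun _ => 0) (inv_nonneg.2 hd.le) one_pos fun c => by
      simp only [Fintype.sum_option, Option.elim, mul_one, mul_zero, Finset.sum_const_zero,
        add_zero]
      by_cases h0 : c none = 0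
      · rw [h0, abs_zero]; positivity
      set z : X := ∑ x : S, c (some x) • (x : X) with hz
      have hrw : c none • F + ∑ x : S, c (some x) • inclusionInDoubleDual ℝ X x =
          c none • (F - inclusionInDoubleDual ℝ X (-(c none)⁻¹ • z)) := by
        rw [neg_smul, map_neg, map_smul, sub_neg_eq_add, smul_add, smul_smul, mul_inv_cancel₀ h0, one_smul,
          hz, map_sum]
        simp only [map_smul]
      rw [hrw, norm_smul, Real.norm_eq_abs, ← mul_assoc, mul_comm d⁻¹, mul_assoc]
      refine le_mul_of_one_le_right (abs_nonneg _) ?_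
      rw [inv_mul_eq_div, one_le_div hd]
      exact hF _
  exact ⟨f, hf, hS none, fun x hx => hS (some ⟨x, hx⟩)⟩

/-- In a non-reflexive space there are bounded sequences with `f m (y n) = 1` for `m ≤ n` and
`f m (y n) = 0` for `n < m`, compatible with a splitting `X = ℝ e ⊕ ker g`. -/
theorem exists_biorthogonal_staircase {X : Type*} [NormedAddCommGroup X] [NormedSpace ℝ X]
    [CompleteSpace X] (h : ¬ Function.Surjective ⇑(inclusionInDoubleDual ℝ X)) :
    ∃ (e : X) (g : StrongDual ℝ X) (f : ℕ → StrongDual ℝ X) (y : ℕ → X) (A B : ℝ),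
      g e = 1 ∧ (∀ m, ‖f m‖ ≤ A) ∧ (∀ n, ‖y n‖ ≤ B) ∧ (∀ m, f m e = 0) ∧ (∀ n, g (y n) = 0) ∧
      (∀ m n, m ≤ n → f m (y n) = 1) ∧ ∀ m n, n < m → f m (y n) = 0 := by
  classical
  obtain ⟨F₀, hF₀⟩ := not_forall.1 h
  obtain ⟨e, he⟩ : ∃ e : X, e ≠ 0 := by
    by_contra! H
    refine hF₀ ⟨0, ?_⟩
    ext f
    have : f = 0 := by ext x; simp [H x]
    simp [this]
  obtain ⟨g₀, -, hg₀⟩ := exists_dual_vector ℝ e (norm_ne_zero_iff.2 he)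
  set g : StrongDual ℝ X := ‖e‖⁻¹ • g₀ with hg
  have hge : g e = 1 := by
    simp [hg, hg₀, norm_ne_zero_iff.2 he]
  set F := F₀ - inclusionInDoubleDual ℝ X (F₀ g • e) with hF
  have hFg : F g = 0 := by simp [hF, hge]
  have hFr : F ∉ Set.range (inclusionInDoubleDual ℝ X) := by
    rintro ⟨x, hx⟩
    exact hF₀ ⟨x + F₀ g • e, by rw [map_add, hx, hF]; abel⟩
  have hisom : Isometry (inclusionInDoubleDual ℝ X) :=
    (inclusionInDoubleDualLi (E := X) ℝ).isometry
  have hclosed : IsClosed (Set.range (inclusionInDoubleDual ℝ X)) :=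
    hisom.isClosedEmbedding.isClosed_range
  obtain ⟨d, hd, hball⟩ := Metric.isOpen_iff.1 hclosed.isOpen_compl F hFr
  have hdist : ∀ x, d ≤ ‖F - inclusionInDoubleDual ℝ X x‖ := fun x => by
    by_contra! H
    refine hball (a := inclusionInDoubleDual ℝ X x) ?_ ⟨x, rfl⟩
    exact Metric.mem_ball'.2 ((dist_eq_norm F _).trans_lt H)
  obtain ⟨u, hu, hr⟩ := exists_seq_of_forall_finset_exists
    (fun p : StrongDual ℝ X × X => ‖p.1‖ ≤ d⁻¹ + 1 ∧ ‖p.2‖ ≤ ‖F‖ + 1 ∧ p.1 e = 0 ∧ g p.2 = 0 ∧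
      p.1 p.2 = 1 ∧ F p.1 = 1)
    (fun p q => q.1 p.2 = 0 ∧ p.1 q.2 = 1) fun s hs => by
      obtain ⟨f, hf, hFf, hfS⟩ := exists_annihilating_functional hd hdist
        (insert e (s.image Prod.snd))
      obtain ⟨y, hy, hyS⟩ := exists_norm_le_forall_mem_apply_eq F
        (insert g (insert f (s.image Prod.fst)))
      refine ⟨(f, y), ⟨hf, hy, hfS e (by simp), (hyS g (by simp)).trans hFg,
        (hyS f (by simp)).trans hFf, hFf⟩, fun p hp => ⟨hfS _ ?_, (hyS _ ?_).trans ?_⟩⟩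
      · exact Finset.mem_insert_of_mem (Finset.mem_image_of_mem _ hp)
      · exact Finset.mem_insert_of_mem
          (Finset.mem_insert_of_mem (Finset.mem_image_of_mem _ hp))
      · exact (hs p hp).2.2.2.2.2
  refine ⟨e, g, fun n => (u n).1, fun n => (u n).2, _, _, hge, fun m => (hu m).1,
    fun n => (hu n).2.1, fun m => (hu m).2.2.1, fun n => (hu n).2.2.2.1, fun m n hmn => ?_,
    fun m n hmn => (hr n m hmn).1⟩
  rcases hmn.eq_or_lt with rfl | hlt
  · exact (hu m).2.2.2.2.1
  · exact (hr m n hlt).2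

/-- The gauge `max √((|g x| + p x)² + ‖x - g x • e‖²) (sup_m |f m x|)`. -/
noncomputable def staircaseNorm {X : Type*} [NormedAddCommGroup X] [NormedSpace ℝ X]
    (e : X) (g : StrongDual ℝ X) (p : Seminorm ℝ X) (f : ℕ → StrongDual ℝ X) (x : X) : ℝ :=
  max √((|g x| + p x) ^ 2 + ‖x - g x • e‖ ^ 2) (⨆ m, |f m x|)

section StaircaseNorm

variable {X : Type*} [NormedAddCommGroup X] [NormedSpace ℝ X]
  {e : X} {g : StrongDual ℝ X} {p : Seminorm ℝ X} {f : ℕ → StrongDual ℝ X} {C : ℝ}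

theorem staircaseNorm_le_iff (hf : ∀ m, ‖f m‖ ≤ C) {x : X} {r : ℝ} (hr : 0 ≤ r) :
    staircaseNorm e g p f x ≤ r ↔
      (|g x| + p x) ^ 2 + ‖x - g x • e‖ ^ 2 ≤ r ^ 2 ∧ ∀ m, |f m x| ≤ r := by
  have hb : BddAbove (Set.range fun m => |f m x|) := by
    refine ⟨C * ‖x‖, ?_⟩
    rintro _ ⟨m, rfl⟩
    exact (f m).le_of_opNorm_le (hf m) x
  rw [staircaseNorm, max_le_iff, Real.sqrt_le_left hr]
  exact and_congr_right fun _ => ciSup_le_iff hb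

theorem staircaseNorm_nonneg (x : X) : 0 ≤ staircaseNorm e g p f x :=
  (Real.sqrt_nonneg _).trans (le_max_left _ _)

theorem isEquivNorm_staircaseNorm (hf : ∀ m, ‖f m‖ ≤ C) (hp : ∀ x, p x ≤ C * ‖x‖) :
    IsEquivNorm (staircaseNorm e g p f) := by
  have key := fun x => (staircaseNorm_le_iff (e := e) (g := g) (p := p) hf (x := x)
    (staircaseNorm_nonneg x)).1 le_rfl
  have hC : 0 ≤ C := (norm_nonneg _).trans (hf 0)
  have hsub : ∀ x y : X, x + y - g (x + y) • e = (x - g x • e) + (y - g y • e) := fun x y => by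
    rw [map_add, add_smul]; abel
  have hsmul : ∀ (a : ℝ) (x : X), a • x - g (a • x) • e = a • (x - g x • e) := fun a x => by
    rw [map_smul, smul_sub, smul_assoc]
  have hle : ∀ (a : ℝ) (x : X),
      staircaseNorm e g p f (a • x) ≤ |a| * staircaseNorm e g p f x := fun a x => by
    obtain ⟨h1, h2⟩ := key x
    refine (staircaseNorm_le_iff hf (mul_nonneg (abs_nonneg _) (staircaseNorm_nonneg x))).2
      ⟨?_, fun m => ?_⟩
    · rw [hsmul, norm_smul, map_smul_eq_mul p, map_smul g, smul_eq_mul, abs_mul, Real.norm_eq_abs]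
      calc _ = |a| ^ 2 * ((|g x| + p x) ^ 2 + ‖x - g x • e‖ ^ 2) := by ring
        _ ≤ |a| ^ 2 * staircaseNorm e g p f x ^ 2 := by gcongr
        _ = _ := by ring
    · rw [map_smul, smul_eq_mul, abs_mul]
      gcongr
      exact h2 m
  refine ⟨fun x y => ?_, fun a x => (hle a x).antisymm ?_, ⟨(‖e‖ + 1)⁻¹, by positivity,
    fun x => ?_⟩, ⟨‖g‖ + C + (1 + ‖g‖ * ‖e‖) + 1, by positivity, fun x => ?_⟩⟩
  · obtain ⟨hx, hx'⟩ := key x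
    obtain ⟨hy, hy'⟩ := key y
    have hx0 := staircaseNorm_nonneg (e := e) (g := g) (p := p) (f := f) x
    have hy0 := staircaseNorm_nonneg (e := e) (g := g) (p := p) (f := f) y
    refine (staircaseNorm_le_iff hf (add_nonneg hx0 hy0)).2 ⟨?_, fun m => ?_⟩
    · have h1 : |g (x + y)| + p (x + y) ≤ (|g x| + p x) + (|g y| + p y) := by
        rw [map_add]
        linarith [abs_add_le (g x) (g y), map_add_le_add p x y]
      have h2 : ‖x + y - g (x + y) • e‖ ≤ ‖x - g x • e‖ + ‖y - g y • e‖ := by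
        rw [hsub]; exact norm_add_le _ _
      have hpx := apply_nonneg p x
      have hpy := apply_nonneg p y
      have hpxy := apply_nonneg p (x + y)
      have h3 : 0 ≤ |g (x + y)| + p (x + y) := by positivity
      set A := |g x| + p x
      set B := |g y| + p y
      set a := ‖x - g x • e‖
      set b := ‖y - g y • e‖
      set r := staircaseNorm e g p f x
      set s := staircaseNorm e g p f y
      have hcs : A * B + a * b ≤ r * s := by
        refine abs_le_of_sq_le_sq' ?_ (by positivity) |>.2
        calc (A * B + a * b) ^ 2 ≤ (A ^ 2 + a ^ 2) * (B ^ 2 + b ^ 2) := by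
              nlinarith [sq_nonneg (A * b - a * B)]
          _ ≤ r ^ 2 * s ^ 2 := by gcongr
          _ = _ := by ring
      calc _ ≤ (A + B) ^ 2 + (a + b) ^ 2 := by gcongr
        _ ≤ _ := by nlinarith
    · rw [map_add]
      exact (abs_add_le _ _).trans (add_le_add (hx' m) (hy' m))
  · rcases eq_or_ne a 0 with rfl | ha
    · simpa using staircaseNorm_nonneg _
    · have := hle a⁻¹ (a • x)
      rw [inv_smul_smul₀ ha, abs_inv, inv_mul_eq_div, le_div_iff₀ (abs_pos.2 ha)] at this
      linarith
  · obtain ⟨h1, -⟩ := key x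
    have h0 := staircaseNorm_nonneg (e := e) (g := g) (p := p) (f := f) x
    have hpx := apply_nonneg p x
    have hgx := abs_nonneg (g x)
    have h2 : |g x| ≤ staircaseNorm e g p f x :=
      abs_le_of_sq_le_sq (by nlinarith [sq_nonneg ‖x - g x • e‖, sq_abs (g x)]) h0
    have h3 : ‖x - g x • e‖ ≤ staircaseNorm e g p f x :=
      abs_le_of_sq_le_sq' (by nlinarith [sq_nonneg (|g x| + p x)]) h0 |>.2
    have h4 : ‖x‖ ≤ ‖x - g x • e‖ + |g x| * ‖e‖ := by
      have := norm_add_le (x - g x • e) (g x • e)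
      rwa [sub_add_cancel, norm_smul, Real.norm_eq_abs] at this
    rw [inv_mul_le_iff₀ (by positivity)]
    nlinarith [mul_le_mul_of_nonneg_right h2 (norm_nonneg e)]
  · have hg : |g x| ≤ ‖g‖ * ‖x‖ := g.le_opNorm x
    have hn : ‖x - g x • e‖ ≤ (1 + ‖g‖ * ‖e‖) * ‖x‖ := by
      have := norm_sub_le x (g x • e)
      rw [norm_smul, Real.norm_eq_abs] at this
      nlinarith [mul_le_mul_of_nonneg_right hg (norm_nonneg e)]
    have hpx := apply_nonneg p x
    have hpC := hp x
    refine (staircaseNorm_le_iff hf (by positivity)).2 ⟨?_, fun m => ?_⟩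
    · calc _ ≤ ((|g x| + p x) + ‖x - g x • e‖) ^ 2 := by
            nlinarith [mul_nonneg (add_nonneg (abs_nonneg (g x)) hpx) (norm_nonneg (x - g x • e))]
        _ ≤ _ := by
            gcongr
            linarith [norm_nonneg x]
    · have h1 : |f m x| ≤ C * ‖x‖ := (f m).le_of_opNorm_le (hf m) x
      have : 0 ≤ (‖g‖ + (1 + ‖g‖ * ‖e‖) + 1) * ‖x‖ := by positivity
      linarith

variable {a : ℕ → ℝ}

theorem staircaseNorm_self (hf : ∀ m, ‖f m‖ ≤ C) (hge : g e = 1) (hpe : p e = 0)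
    (hfe : ∀ m, |f m e| ≤ 1) : staircaseNorm e g p f e = 1 := by
  refine le_antisymm ((staircaseNorm_le_iff hf zero_le_one).2 ⟨?_, hfe⟩) ?_
  · simp [hge, hpe]
  · have := ((staircaseNorm_le_iff (e := e) (g := g) (p := p) hf (x := e)
      (staircaseNorm_nonneg e)).1 le_rfl).1
    simp only [hge, hpe, one_smul, sub_self, norm_zero, abs_one] at this
    exact abs_le_of_sq_le_sq' (by linarith) (staircaseNorm_nonneg e) |>.2

theorem le_seminorm_of_le_staircaseNorm (hf : ∀ m, ‖f m‖ ≤ C) (hge : g e = 1)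
    (hpe : p e = 0) (hfe : ∀ m, f m e = a m) (ha0 : ∀ m, 0 ≤ a m) (ha : StrictMono a)
    (ha1 : ∀ m, a m < 1) (hlim : ∀ y, g y = 0 → ∀ ε > 0, ∀ᶠ m in atTop, |f m y| ≤ p y + ε)
    {φ : StrongDual ℝ X} (hφ : ∀ x, |φ x| ≤ staircaseNorm e g p f x) (hφe : φ e = 1)
    {y : X} (hy : g y = 0) : φ y ≤ p y := by
  refine le_of_forall_pos_le_add fun ε hε => ?_
  obtain ⟨M, hM⟩ := eventually_atTop.1 (hlim y hy ε hε)
  have hC : 0 ≤ C := (norm_nonneg _).trans (hf 0)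
  have hpy := apply_nonneg p y
  obtain ⟨s, hs0, hs1, hs2⟩ : ∃ s : ℝ, 0 < s ∧ s * ‖y‖ ^ 2 ≤ ε ∧ s * (C * ‖y‖) ≤ 1 - a M := by
    have h1 : 0 < 1 - a M := sub_pos.2 (ha1 M)
    refine ⟨min (ε / (‖y‖ ^ 2 + 1)) ((1 - a M) / (C * ‖y‖ + 1)), by positivity, ?_, ?_⟩
    · calc _ ≤ ε / (‖y‖ ^ 2 + 1) * ‖y‖ ^ 2 := by gcongr; exact min_le_left _ _
        _ ≤ ε := by
          rw [div_mul_eq_mul_div, div_le_iff₀ (by positivity)]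
          nlinarith
    · calc _ ≤ (1 - a M) / (C * ‖y‖ + 1) * (C * ‖y‖) := by gcongr; exact min_le_right _ _
        _ ≤ _ := by
          rw [div_mul_eq_mul_div, div_le_iff₀ (by positivity)]
          nlinarith
  have hbound : staircaseNorm e g p f (e + s • y) ≤ 1 + s * (p y + ε) := by
    refine (staircaseNorm_le_iff hf (by positivity)).2 ⟨?_, fun m => ?_⟩
    · have hg1 : g (e + s • y) = 1 := by simp [hge, hy]
      have hp1 : p (e + s • y) ≤ s * p y := by
        have := map_add_le_add p e (s • y)
        rwa [hpe, zero_add, map_smul_eq_mul, Real.norm_eq_abs, abs_of_pos hs0] at this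
      rw [hg1, one_smul, add_sub_cancel_left, norm_smul, Real.norm_eq_abs, abs_of_pos hs0, abs_one]
      have hp0 := apply_nonneg p (e + s • y)
      calc _ ≤ (1 + s * p y) ^ 2 + (s * ‖y‖) ^ 2 := by gcongr
        _ = (1 + s * p y) ^ 2 + s * (s * ‖y‖ ^ 2) := by ring
        _ ≤ (1 + s * p y) ^ 2 + s * ε := by gcongr
        _ ≤ (1 + s * p y) ^ 2 + 2 * (1 + s * p y) * (s * ε) + (s * ε) ^ 2 := by
            nlinarith [mul_pos hs0 hε, mul_nonneg (mul_nonneg hs0.le hpy) (mul_pos hs0 hε).le]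
        _ = _ := by ring
    · rw [map_add, map_smul, smul_eq_mul, hfe]
      have habs : |a m + s * f m y| ≤ a m + s * |f m y| := by
        refine (abs_add_le _ _).trans_eq ?_
        rw [abs_of_nonneg (ha0 m), abs_mul, abs_of_pos hs0]
      refine habs.trans ?_
      rcases le_total M m with hm | hm
      · gcongr
        · exact (ha1 m).le
        · exact hM m hm
      · have h1 : s * |f m y| ≤ s * (C * ‖y‖) := by
          gcongr
          exact (f m).le_of_opNorm_le (hf m) y
        have h2 := ha.monotone hm
        have h3 : 0 ≤ s * (p y + ε) := by positivity
        linarith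
  have h1 := (le_abs_self _).trans ((hφ (e + s • y)).trans hbound)
  rw [map_add, map_smul, hφe, smul_eq_mul] at h1
  exact le_of_mul_le_mul_left (by linarith) hs0

theorem nsePoint_staircaseNorm (hf : ∀ m, ‖f m‖ ≤ C) (hge : g e = 1)
    (hpe : p e = 0) (hfe : ∀ m, f m e = a m) (ha0 : ∀ m, 0 ≤ a m) (ha : StrictMono a)
    (ha1 : ∀ m, a m < 1) (hlim : ∀ y, g y = 0 → ∀ ε > 0, ∀ᶠ m in atTop, |f m y| ≤ p y + ε) :
    NSEPoint (staircaseNorm e g p f) e := by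
  intro φ hφ hφe z hz hφz
  have hker : ∀ x, g (x - g x • e) = 0 := fun x => by simp [hge]
  have hdecomp : ∀ x, φ x = g x + φ (x - g x • e) := fun x => by simp [hφe]
  have hpz : ∀ x, p (x - g x • e) ≤ p x := fun x => by
    have := map_sub_le_add p x (g x • e)
    rwa [map_smul_eq_mul, hpe, mul_zero, add_zero] at this
  have hφle : ∀ x, φ x ≤ |g x| + p x := fun x => by
    rw [hdecomp]
    exact add_le_add (le_abs_self _) ((le_seminorm_of_le_staircaseNorm hf hge hpe hfe ha0 ha ha1
      hlim hφ.1 hφe (hker x)).trans (hpz x))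
  have hball := fun n => ((staircaseNorm_le_iff hf zero_le_one).1 (hz n)).1
  have hsq : Tendsto (fun n => ‖z n - g (z n) • e‖ ^ 2) atTop (𝓝 0) := by
    have hup : Tendsto (fun n => 1 - φ (z n) ^ 2) atTop (𝓝 0) := by
      simpa using (hφz.pow 2).const_sub 1
    refine tendsto_of_tendsto_of_tendsto_of_le_of_le' tendsto_const_nhds hup
      (Eventually.of_forall fun n => sq_nonneg _) ?_
    filter_upwards [hφz.eventually (lt_mem_nhds one_pos)] with n hn
    have := pow_le_pow_left₀ hn.le (hφle (z n)) 2
    linarith [hball n]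
  have hP : Tendsto (fun n => z n - g (z n) • e) atTop (𝓝 0) := by
    rw [tendsto_zero_iff_norm_tendsto_zero]
    simpa using hsq.sqrt
  have hg : Tendsto (fun n => g (z n)) atTop (𝓝 1) := by
    have := hφz.sub ((φ.continuous.tendsto 0).comp hP)
    simp only [map_zero, sub_zero] at this
    refine this.congr fun n => ?_
    rw [hdecomp (z n)]
    simp
  simpa using hP.add (hg.smul_const e)

theorem not_alurPoint_staircaseNorm (hf : ∀ m, ‖f m‖ ≤ C) (hge : g e = 1)
    (hpe : p e = 0) (hfe : ∀ m, f m e = a m) (ha0 : ∀ m, 0 ≤ a m)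
    (ha1 : ∀ m, a m < 1) (halim : Tendsto a atTop (𝓝 1)) {w : ℕ → X} {b : ℝ} (hb0 : 0 ≤ b)
    (hb1 : b < 1) (hgw : ∀ n, g (w n) = 0) (hpw : ∀ n, p (w n) = 0)
    (hw : ∀ n, b ^ 2 + ‖w n‖ ^ 2 ≤ 1) (hfw : ∀ m n, m ≤ n → f m (w n) = 1 - b * a m)
    (hfw' : ∀ m n, n < m → f m (w n) = 0) :
    ¬ ALURPoint (staircaseNorm e g p f) e := by
  intro H
  have hfN : ∀ m x, |f m x| ≤ staircaseNorm e g p f x := fun m x =>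
    ((staircaseNorm_le_iff hf (staircaseNorm_nonneg x)).1 le_rfl).2 m
  have hfx : ∀ m n, m ≤ n → f m (b • e + w n) = 1 := fun m n hmn => by
    simp [hfe, hfw m n hmn]
  have hgx : ∀ n, g (b • e + w n) = b := fun n => by simp [hge, hgw]
  have hN : ∀ n, staircaseNorm e g p f (b • e + w n) = 1 := fun n => by
    refine le_antisymm ((staircaseNorm_le_iff hf zero_le_one).2 ⟨?_, fun m => ?_⟩) ?_
    · have hp1 : p (b • e + w n) ≤ 0 := by
        have := map_add_le_add p (b • e) (w n)
        rwa [map_smul_eq_mul, hpe, hpw, mul_zero, add_zero] at this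
      rw [hgx, add_sub_cancel_left, le_antisymm hp1 (apply_nonneg p _), add_zero, sq_abs, one_pow]
      exact hw n
    · rcases le_or_gt m n with hmn | hmn
      · rw [hfx m n hmn, abs_one]
      · rw [map_add, map_smul, hfe, hfw' m n hmn, add_zero, smul_eq_mul,
          abs_of_nonneg (mul_nonneg hb0 (ha0 m))]
        exact mul_le_one₀ hb1.le (ha0 m) (ha1 m).le
    · have := hfN n (b • e + w n)
      rwa [hfx n n le_rfl, abs_one] at this
  have hlim := H (fun n => b • e + w n) f (fun m => 2⁻¹ * (1 + a m)) hN
    (fun m => ⟨hfN m, fun c hc => by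
      have := hc (b • e + w m)
      rwa [hfx m m le_rfl, hN, abs_one, mul_one] at this⟩)
    (fun m => by
      refine tendsto_const_nhds.congr' ?_
      filter_upwards [eventually_ge_atTop m] with n hn
      rw [map_smul, map_add, hfx m n hn, hfe, smul_eq_mul])
    (by
      have := (halim.const_add 1).const_mul (2⁻¹ : ℝ)
      rwa [one_add_one_eq_two, inv_mul_cancel₀ two_ne_zero] at this)
  have h1 := (g.continuous.tendsto e).comp hlim
  rw [hge] at h1
  have h2 : Tendsto (fun _ : ℕ => b) atTop (𝓝 1) := h1.congr hgx
  exact hb1.ne (tendsto_nhds_unique tendsto_const_nhds h2)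

end StaircaseNorm

/-- A continuous seminorm dominating `limsup |k m y|` and vanishing wherever `k m x` is eventually
zero. -/
theorem exists_seminorm_of_eventually_apply_eq_zero {X : Type*} [NormedAddCommGroup X]
    [NormedSpace ℝ X] {k : ℕ → StrongDual ℝ X} {K : ℝ} (hK : ∀ m, ‖k m‖ ≤ K) :
    ∃ p : Seminorm ℝ X, (∀ x, p x ≤ K * ‖x‖) ∧ (∀ x, (∀ᶠ m in atTop, k m x = 0) → p x = 0) ∧
      ∀ y, ∀ ε > 0, ∀ᶠ m in atTop, |k m y| ≤ p y + ε := by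
  have hK0 : 0 ≤ K := (norm_nonneg _).trans (hK 0)
  let Z : Submodule ℝ X :=
    { carrier := {x | ∀ᶠ m in atTop, k m x = 0}
      zero_mem' := by simp
      add_mem' := fun {x y} hx hy => by
        filter_upwards [hx, hy] with m h1 h2
        rw [map_add, h1, h2, add_zero]
      smul_mem' := fun c x hx => by
        filter_upwards [hx] with m h1
        rw [map_smul, h1, smul_zero] }
  lift K to NNReal using hK0
  let p : Seminorm ℝ X := K • (normSeminorm ℝ (X ⧸ Z)).comp Z.mkQ
  have hpx : ∀ x, p x = K * ‖(Submodule.Quotient.mk x : X ⧸ Z)‖ := fun x => rfl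
  refine ⟨p, fun x => ?_, fun x hx => ?_, fun y ε hε => ?_⟩
  · rw [hpx]
    gcongr
    exact Submodule.Quotient.norm_mk_le Z x
  · rw [hpx, (Submodule.Quotient.mk_eq_zero Z).2 hx, norm_zero, mul_zero]
  · obtain ⟨x, hx, hlt⟩ := Submodule.Quotient.norm_mk_lt (Submodule.Quotient.mk y : X ⧸ Z)
      (show 0 < ε / (K + 1) by positivity)
    have hZ : ∀ᶠ m in atTop, k m (x - y) = 0 := (Submodule.Quotient.eq Z).1 hx
    filter_upwards [hZ] with m hm
    rw [map_sub, sub_eq_zero] at hm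
    rw [← hm, hpx]
    have h1 : |k m x| ≤ K * ‖x‖ := (k m).le_of_opNorm_le (hK m) x
    have h2 : K * (ε / (K + 1)) ≤ ε := by
      rw [mul_div_assoc', div_le_iff₀ (by positivity)]
      nlinarith
    nlinarith [mul_le_mul_of_nonneg_left hlt.le K.coe_nonneg]

/-- Every non-reflexive Banach space admits an equivalent norm whose unit sphere contains
an NSE point which is not an aLUR point. -/
theorem nonreflexive_renorming_NSE_not_aLUR {X : Type*} [NormedAddCommGroup X]
    [NormedSpace ℝ X] [CompleteSpace X]
    (h : ¬ Function.Surjective ⇑(inclusionInDoubleDual ℝ X)) :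
    ∃ N : X → ℝ, IsEquivNorm N ∧
      ∃ x : X, N x = 1 ∧ NSEPoint N x ∧ ¬ ALURPoint N x := by
  obtain ⟨e, g, h, y, A, B, hge, hA, hB, hhe, hgy, hhy, hhy'⟩ := exists_biorthogonal_staircase h
  have hB0 : 0 ≤ B := (norm_nonneg _).trans (hB 0)
  have hA0 : 0 ≤ A := (norm_nonneg _).trans (hA 0)
  set s : ℝ := (1 + B ^ 2)⁻¹ with hs
  have hs0 : 0 < s := by positivity
  have hs1 : s ≤ 1 := inv_le_one_of_one_le₀ (by nlinarith [sq_nonneg B])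
  have hsB : s * (1 + B ^ 2) = 1 := inv_mul_cancel₀ (by positivity)
  set a : ℕ → ℝ := fun m => 1 - 1 / ((m : ℝ) + 1) with ha
  have ha0 : ∀ m, 0 ≤ a m := fun m => by
    rw [ha, sub_nonneg, div_le_one (by positivity)]
    linarith [Nat.cast_nonneg (α := ℝ) m]
  have ha1 : ∀ m, a m < 1 := fun m => sub_lt_self _ (by positivity)
  have hmono : StrictMono a := fun m n hmn => by
    have : (m : ℝ) < n := Nat.cast_lt.2 hmn
    simp only [ha]
    gcongr
  have halim : Tendsto a atTop (𝓝 1) := by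
    simpa [ha] using (tendsto_one_div_add_atTop_nhds_zero_nat (𝕜 := ℝ)).const_sub 1
  set k : ℕ → StrongDual ℝ X := fun m => ((1 - (1 - s) * a m) / s) • h m with hk
  have hkK : ∀ m, ‖k m‖ ≤ s⁻¹ * A := fun m => by
    have h1 : 0 ≤ (1 - s) * a m := mul_nonneg (sub_nonneg.2 hs1) (ha0 m)
    have h2 : (1 - s) * a m ≤ 1 := mul_le_one₀ (by linarith) (ha0 m) (ha1 m).le
    rw [hk, norm_smul, Real.norm_eq_abs, abs_of_nonneg (div_nonneg (by linarith) hs0.le)]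
    gcongr
    · rw [div_le_iff₀ hs0, inv_mul_cancel₀ hs0.ne']
      linarith
    · exact hA m
  obtain ⟨p, hpK, hp0, hplim⟩ := exists_seminorm_of_eventually_apply_eq_zero hkK
  set f : ℕ → StrongDual ℝ X := fun m => a m • g + k m with hf
  have hfC : ∀ m, ‖f m‖ ≤ ‖g‖ + s⁻¹ * A := fun m => by
    refine (norm_add_le _ _).trans (add_le_add ?_ (hkK m))
    rw [norm_smul, Real.norm_eq_abs, abs_of_nonneg (ha0 m)]
    exact mul_le_of_le_one_left (norm_nonneg _) (ha1 m).le
  have hpe : p e = 0 := hp0 e (Eventually.of_forall fun m => by simp [hk, hhe])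
  have hfe : ∀ m, f m e = a m := fun m => by simp [hf, hk, hge, hhe]
  have hlim : ∀ y, g y = 0 → ∀ ε > 0, ∀ᶠ m in atTop, |f m y| ≤ p y + ε := fun y hy ε hε => by
    simpa [hf, hy] using hplim y ε hε
  refine ⟨staircaseNorm e g p f, isEquivNorm_staircaseNorm hfC fun x => (hpK x).trans ?_, e,
    staircaseNorm_self hfC hge hpe fun m => ?_,
    nsePoint_staircaseNorm hfC hge hpe hfe ha0 hmono ha1 hlim,
    not_alurPoint_staircaseNorm hfC hge hpe hfe ha0 ha1 halim (w := fun n => s • y n)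
      (sub_nonneg.2 hs1) (sub_lt_self 1 hs0) (fun n => by simp [hgy]) (fun n => hp0 _ ?_)
      (fun n => ?_) (fun m n hmn => ?_) fun m n hmn => ?_⟩
  · gcongr
    exact le_add_of_nonneg_left (norm_nonneg g)
  · rw [hfe, abs_of_nonneg (ha0 m)]
    exact (ha1 m).le
  · filter_upwards [eventually_gt_atTop n] with m hm
    simp [hk, hhy' m n hm]
  · have h1 : ‖s • y n‖ ≤ s * B := by
      rw [norm_smul, Real.norm_eq_abs, abs_of_pos hs0]
      gcongr
      exact hB n
    have h2 := pow_le_pow_left₀ (norm_nonneg _) h1 2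
    nlinarith
  · simp [hf, hk, hgy, hhy m n hmn]
    field_simp
  · simp [hf, hk, hgy, hhy' m n hmn]
end
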